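/- arXiv:0803.4281 — 3 statements merged into one kernel-verified Lean document; each statement's English description precedes it below -/
import Mathlib

section
/- Let G be a finitely generated group such that for every finite-index normal subgroup G₀ of G, every group homomorphism G₀ → (ℝ,+) is trivial. Let ρ be a C¹ action of G on the circle that preserves some Borel probability measure μ on S¹ (the pushforward of μ under ρ(g) equals μ for all g ∈ G). Then ρ factors through a finite group: the kernel of ρ has finite index in G. -/
open MeasureTheory

/-- The group of self-homeomorphisms of the circle `S¹ = ℝ/ℤ`,
with `f * g = f ∘ g`. -/
noncomputable instance : Group (UnitAddCircle ≃ₜ UnitAddCircle) where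
  mul f g := g.trans f
  one := Homeomorph.refl _
  inv := Homeomorph.symm
  mul_assoc _ _ _ := Homeomorph.ext fun _ => rfl
  one_mul _ := Homeomorph.ext fun _ => rfl
  mul_one _ := Homeomorph.ext fun _ => rfl
  inv_mul_cancel a := Homeomorph.ext a.symm_apply_apply

/-- `F : ℝ → ℝ` is a `C¹` lift of the circle homeomorphism `f`: it is `C¹` with
nowhere-vanishing derivative, commutes with the deck transformation up to sign,
and descends to `f` on `ℝ/ℤ`. -/
def IsC1Lift (f : UnitAddCircle ≃ₜ UnitAddCircle) (F : ℝ → ℝ) : Prop :=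
  ContDiff ℝ 1 F ∧ (∀ x : ℝ, deriv F x ≠ 0) ∧
    ((∀ x : ℝ, F (x + 1) = F x + 1) ∨ (∀ x : ℝ, F (x + 1) = F x - 1)) ∧
    ∀ x : ℝ, f (x : UnitAddCircle) = ((F x : ℝ) : UnitAddCircle)

/-- A `C¹` action of a group `Γ` on the circle: a homomorphism into the
self-homeomorphisms of the circle all of whose values admit `C¹` lifts. -/
def IsC1Action {Γ : Type*} [Group Γ] (ρ : Γ →* (UnitAddCircle ≃ₜ UnitAddCircle)) : Prop :=
  ∀ γ : Γ, ∃ F : ℝ → ℝ, IsC1Lift (ρ γ) F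

/-- `F : ℝ → ℝ` is an orientation-preserving `C¹` lift of the circle
homeomorphism `f`: it is `C¹` with everywhere positive derivative,
satisfies `F (x+1) = F x + 1` and descends to `f` on `ℝ/ℤ`. -/
def IsOPC1Lift (f : UnitAddCircle ≃ₜ UnitAddCircle) (F : ℝ → ℝ) : Prop :=
  ContDiff ℝ 1 F ∧ (∀ x : ℝ, 0 < deriv F x) ∧
    (∀ x : ℝ, F (x + 1) = F x + 1) ∧
    ∀ x : ℝ, f (x : UnitAddCircle) = ((F x : ℝ) : UnitAddCircle)

/-- `F : ℝ → ℝ` is an orientation-preserving (topological) lift of the circle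
homeomorphism `f`: continuous, strictly increasing, satisfies
`F (x+1) = F x + 1`, and descends to `f` on `ℝ/ℤ`. -/
def IsOPLift (f : UnitAddCircle ≃ₜ UnitAddCircle) (F : ℝ → ℝ) : Prop :=
  Continuous F ∧ StrictMono F ∧
    (∀ x : ℝ, F (x + 1) = F x + 1) ∧
    ∀ x : ℝ, f (x : UnitAddCircle) = ((F x : ℝ) : UnitAddCircle)

open Filter Asymptotics Topology

section ThurstonStability

variable {Γ : Type*} [Group Γ] {F : Γ → ℝ → ℝ} {p : ℝ}

/-- Displacements at a parabolic common fixed point are additive to first order. -/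
theorem displacement_mul_isLittleO
    (hmul : ∀ γ δ x, F (γ * δ) x = F γ (F δ x))
    (hcont : ∀ γ, Continuous (F γ)) (hder : ∀ γ, HasStrictDerivAt (F γ) 1 p)
    (hfix : ∀ γ, F γ p = p) (γ δ : Γ) :
    (fun x => (F (γ * δ) x - x) - ((F γ x - x) + (F δ x - x))) =o[𝓝 p] fun x => F δ x - x := by
  have hlim : Tendsto (fun x => (F δ x, x)) (𝓝 p) (𝓝 (p, p)) := by
    have := ((hcont δ).prodMk continuous_id).tendsto p
    simpa [hfix] using this
  have h := (hasStrictFDerivAt_iff_isLittleO.1 (hder γ).hasStrictFDerivAt).comp_tendsto hlim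
  refine (h.congr_left fun x => ?_)
  simp [hmul]
  ring

/-- A quantity dominating the displacements of a generating set dominates all displacements. -/
theorem displacement_isBigO
    (hone : ∀ x, F 1 x = x) (hmul : ∀ γ δ x, F (γ * δ) x = F γ (F δ x))
    (hcont : ∀ γ, Continuous (F γ)) (hder : ∀ γ, HasStrictDerivAt (F γ) 1 p)
    (hfix : ∀ γ, F γ p = p) {S : Set Γ} (hS : Subgroup.closure S = ⊤) {M : ℝ → ℝ}
    {l : Filter ℝ} (hl : l ≤ 𝓝 p) (hM : ∀ s ∈ S, (fun x => F s x - x) =O[l] M) (γ : Γ) :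
    (fun x => F γ x - x) =O[l] M := by
  have hadd := fun γ δ => (displacement_mul_isLittleO hmul hcont hder hfix γ δ).mono hl
  have hγ : γ ∈ Subgroup.closure S := hS ▸ Subgroup.mem_top γ
  induction hγ using Subgroup.closure_induction with
  | mem s hs => exact hM s hs
  | one => simpa [hone] using isBigO_zero M l
  | mul γ δ _ _ ihγ ihδ =>
    refine (((hadd γ δ).isBigO.trans ihδ).add (ihγ.add ihδ)).congr_left fun x => ?_
    ring
  | inv γ _ ih =>
    refine (((hadd γ⁻¹ γ).isBigO.trans ih).neg_left.sub ih).congr_left fun x => ?_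
    simp only [inv_mul_cancel, hone]
    ring

/-- **Thurston stability.** If a finitely generated group acts near a parabolic common fixed
point which is a limit of points that are not fixed by the whole group, then the group has a
nontrivial homomorphism to the reals. -/
theorem exists_hom_real_ne_one_of_parabolic [Group.FG Γ]
    (hone : ∀ x, F 1 x = x) (hmul : ∀ γ δ x, F (γ * δ) x = F γ (F δ x))
    (hcont : ∀ γ, Continuous (F γ)) (hder : ∀ γ, HasStrictDerivAt (F γ) 1 p)
    (hfix : ∀ γ, F γ p = p) (hp : p ∈ closure {x | ∃ γ, F γ x ≠ x}) :
    ∃ φ : Γ →* Multiplicative ℝ, φ ≠ 1 := by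
  obtain ⟨S, hS⟩ := Group.fg_def.1 ‹Group.FG Γ›
  set M : ℝ → ℝ := fun x => ∑ s ∈ S, |F s x - x|
  have hMfix : ∀ x, M x = 0 → ∀ γ, F γ x = x := by
    intro x hx γ
    have hs : ∀ s ∈ S, F s x = x := fun s hs => by
      have := (Finset.sum_eq_zero_iff_of_nonneg fun i _ => abs_nonneg (F i x - x)).1 hx s hs
      linarith [abs_eq_zero.1 this]
    have hγ : γ ∈ Subgroup.closure (S : Set Γ) := hS ▸ Subgroup.mem_top γ
    induction hγ using Subgroup.closure_induction with
    | mem s h => exact hs s h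
    | one => exact hone x
    | mul γ δ _ _ ihγ ihδ => rw [hmul, ihδ, ihγ]
    | inv γ _ ih => rw [← ih, ← hmul, inv_mul_cancel, hone, ih]
  have : NeBot (𝓝 p ⊓ 𝓟 {x | ∃ γ, F γ x ≠ x}) := mem_closure_iff_clusterPt.1 hp
  set l : Ultrafilter ℝ := Ultrafilter.of (𝓝 p ⊓ 𝓟 {x | ∃ γ, F γ x ≠ x})
  have hle : (l : Filter ℝ) ≤ 𝓝 p ⊓ 𝓟 {x | ∃ γ, F γ x ≠ x} := Ultrafilter.of_le _
  have hl : (l : Filter ℝ) ≤ 𝓝 p := hle.trans inf_le_left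
  have hM0 : ∀ᶠ x in (l : Filter ℝ), M x ≠ 0 := by
    have : ∀ᶠ x in (l : Filter ℝ), ∃ γ, F γ x ≠ x := le_principal_iff.1 (hle.trans inf_le_right)
    filter_upwards [this] with x ⟨γ, hγ⟩ h0 using hγ (hMfix x h0 γ)
  have hO : ∀ γ, (fun x => F γ x - x) =O[(l : Filter ℝ)] M := by
    refine displacement_isBigO hone hmul hcont hder hfix hS hl fun s hs => ?_
    refine IsBigO.of_norm_le fun x => ?_
    exact Finset.single_le_sum (f := fun s => |F s x - x|) (fun _ _ => abs_nonneg _) hs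
  have hlim : ∀ γ, ∃ a, Tendsto (fun x => (F γ x - x) / M x) l (𝓝 a) := by
    intro γ
    obtain ⟨C, hC⟩ := (hO γ).bound
    have hmem : ∀ᶠ x in (l : Filter ℝ), (F γ x - x) / M x ∈ Set.Icc (-C) C := by
      filter_upwards [hC, hM0] with x hx hx0
      rw [Set.mem_Icc, ← abs_le, abs_div, div_le_iff₀ (abs_pos.2 hx0)]
      exact hx
    obtain ⟨a, -, ha⟩ := isCompact_Icc.ultrafilter_le_nhds
      (l.map fun x => (F γ x - x) / M x) (le_principal_iff.2 hmem)
    exact ⟨a, ha⟩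
  choose φ hφ using hlim
  have hφmul : ∀ γ δ, φ (γ * δ) = φ γ + φ δ := by
    intro γ δ
    have h0 := (((displacement_mul_isLittleO hmul hcont hder hfix γ δ).mono hl).trans_isBigO
      (hO δ)).tendsto_div_nhds_zero
    refine tendsto_nhds_unique (hφ (γ * δ)) ?_
    have := h0.add ((hφ γ).add (hφ δ))
    rw [zero_add] at this
    refine this.congr fun x => ?_
    ring
  refine ⟨MonoidHom.mk' (fun γ => Multiplicative.ofAdd (φ γ)) fun γ δ => by
    rw [hφmul, ofAdd_add], fun h => ?_⟩
  have hφ0 : ∀ γ, φ γ = 0 := fun γ => by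
    have := DFunLike.congr_fun h γ
    simpa using this
  have hsum : Tendsto (fun x => ∑ s ∈ S, |(F s x - x) / M x|) l (𝓝 (∑ s ∈ S, |φ s|)) :=
    tendsto_finsetSum _ fun s _ => (hφ s).abs
  have hone' : (fun x => ∑ s ∈ S, |(F s x - x) / M x|) =ᶠ[(l : Filter ℝ)] fun _ => 1 := by
    filter_upwards [hM0] with x hx
    have hpos : 0 ≤ M x := Finset.sum_nonneg fun _ _ => abs_nonneg _
    simp_rw [abs_div, abs_of_nonneg hpos, ← Finset.sum_div]
    exact div_self hx
  have := tendsto_nhds_unique (hsum.congr' hone') tendsto_const_nhds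
  simp [hφ0] at this

/-- A finitely generated group without nontrivial homomorphisms to the reals has no nontrivial
`C¹` action on the line with a common fixed point. -/
theorem eq_self_of_C1_of_common_fixed_point [Group.FG Γ]
    (hhom : ∀ φ : Γ →* Multiplicative ℝ, φ = 1)
    (hone : ∀ x, F 1 x = x) (hmul : ∀ γ δ x, F (γ * δ) x = F γ (F δ x))
    (hC : ∀ γ, ContDiff ℝ 1 (F γ)) (hpos : ∀ γ x, 0 < deriv (F γ) x)
    {x₀ : ℝ} (hx₀ : ∀ γ, F γ x₀ = x₀) (γ : Γ) (x : ℝ) : F γ x = x := by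
  have hdiff : ∀ γ, Differentiable ℝ (F γ) := fun γ => (hC γ).differentiable one_ne_zero
  set Fix : Set ℝ := {x | ∀ γ, F γ x = x} with hFix
  have hclosed : IsClosed Fix := by
    rw [hFix, Set.ofPred_forall]
    exact isClosed_iInter fun γ => isClosed_eq (hC γ).continuous continuous_id
  by_contra hne
  have hfr : (frontier Fix).Nonempty := nonempty_frontier_iff.2
    ⟨⟨x₀, hx₀⟩, fun h => hne ((h ▸ Set.mem_univ x : x ∈ Fix) γ)⟩
  obtain ⟨p, hp⟩ := hfr
  rw [frontier_eq_closure_inter_closure, hclosed.closure_eq] at hp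
  obtain ⟨hfix, hp⟩ := hp
  let L : Γ →* Multiplicative ℝ :=
    MonoidHom.mk' (fun γ => Multiplicative.ofAdd (Real.log (deriv (F γ) p))) fun γ δ => by
      have hcomp : F (γ * δ) = F γ ∘ F δ := funext fun x => hmul γ δ x
      rw [hcomp, deriv_comp _ (hdiff γ _) (hdiff δ _), hfix δ,
        Real.log_mul (hpos γ p).ne' (hpos δ p).ne', ofAdd_add]
  have hder : ∀ γ, HasStrictDerivAt (F γ) 1 p := by
    intro γ
    have h0 : Real.log (deriv (F γ) p) = 0 := by
      have := DFunLike.congr_fun (hhom L) γ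
      simpa [L] using this
    have h1 : deriv (F γ) p = 1 := Real.eq_one_of_pos_of_log_eq_zero (hpos γ p) h0
    exact h1 ▸ (hC γ).hasStrictDerivAt one_ne_zero
  obtain ⟨φ, hφ⟩ := exists_hom_real_ne_one_of_parabolic hone hmul
    (fun γ => (hC γ).continuous) hder hfix (by
      convert hp using 2
      ext x
      simp [hFix])
  exact hφ (hhom φ)

end ThurstonStability

section RealHoms

/-- A homomorphism to `(ℝ, +)` that vanishes on a finite index subgroup is trivial. -/
theorem hom_real_eq_one_of_finiteIndex {H : Type*} [Group H] (N : Subgroup H) [N.FiniteIndex]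
    (φ : H →* Multiplicative ℝ) (hφ : ∀ n ∈ N, φ n = 1) : φ = 1 := by
  ext h
  obtain ⟨n, hn, -, hmem⟩ := Subgroup.exists_pow_mem_of_index_ne_zero
    (Subgroup.FiniteIndex.index_ne_zero (H := N)) h
  have h0 := congrArg Multiplicative.toAdd (hφ _ hmem)
  rw [map_pow, toAdd_pow, toAdd_one, smul_eq_zero] at h0
  exact h0.resolve_left hn.ne'

/-- If normal finite index subgroups have no nontrivial homomorphisms to `(ℝ, +)`, then neither
do arbitrary finite index subgroups. -/
theorem hom_real_eq_one_of_forall_normal {G : Type*} [Group G]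
    (hG : ∀ N : Subgroup G, N.Normal → N.FiniteIndex → ∀ φ : N →* Multiplicative ℝ, φ = 1)
    (H : Subgroup G) [H.FiniteIndex] (φ : H →* Multiplicative ℝ) : φ = 1 := by
  refine hom_real_eq_one_of_finiteIndex (H.normalCore.subgroupOf H) φ fun n hn => ?_
  have h := hG H.normalCore inferInstance inferInstance
    (φ.comp (Subgroup.inclusion H.normalCore_le))
  exact DFunLike.congr_fun h ⟨n, hn⟩

/-- A finitely generated group without nontrivial homomorphisms to `(ℝ, +)` has finite image
under any homomorphism to a commutative group. -/
theorem finite_range_of_hom_real_eq_one {Γ A : Type*} [Group Γ] [Group.FG Γ] [CommGroup A]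
    (hΓ : ∀ φ : Γ →* Multiplicative ℝ, φ = 1) (f : Γ →* A) : Finite f.range := by
  obtain ⟨ι, j, _, _, p, hp, e, ⟨E⟩⟩ :=
    CommGroup.equiv_free_prod_prod_multiplicative_zmod f.range
  have : ∀ i, NeZero (p i ^ e i) := fun i => ⟨pow_ne_zero _ (hp i).ne_zero⟩
  rcases isEmpty_or_nonempty j with hj | ⟨⟨i⟩⟩
  · have : ∀ i, Finite (Multiplicative (ZMod (p i ^ e i))) := fun i =>
      inferInstanceAs (Finite (ZMod (p i ^ e i)))
    exact Finite.of_equiv _ E.symm.toEquiv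
  · exfalso
    classical
    let c : Multiplicative ℤ →* Multiplicative ℝ :=
      AddMonoidHom.toMultiplicative (Int.castAddHom ℝ)
    let ψ : f.range →* Multiplicative ℝ :=
      c.comp ((Pi.evalMonoidHom _ i).comp ((MonoidHom.fst _ _).comp E.toMonoidHom))
    obtain ⟨γ, hγ⟩ := f.rangeRestrict_surjective (E.symm (fun _ => Multiplicative.ofAdd 1, 1))
    have h := DFunLike.congr_fun (hΓ (ψ.comp f.rangeRestrict)) γ
    have h1 := congrArg Multiplicative.toAdd h
    simp [ψ, c, hγ] at h1

end RealHoms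

section TranslationNumber

/-- The cumulative distribution function of the periodic lift to `ℝ` of a measure on the
circle. -/
noncomputable def circleCdf (μ : Measure UnitAddCircle) (x : ℝ) : ℝ :=
  ∫ t, (⌈x - (AddCircle.equivIco 1 0 t : ℝ)⌉ : ℝ) ∂μ

theorem measurable_equivIco_coe :
    Measurable fun t : UnitAddCircle => (AddCircle.equivIco 1 0 t : ℝ) :=
  measurable_subtype_coe.comp (AddCircle.measurableEquivIco 1 0).measurable

variable (μ : Measure UnitAddCircle) [IsProbabilityMeasure μ]

theorem integrable_ceil_sub_equivIco (x : ℝ) :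
    Integrable (fun t : UnitAddCircle => (⌈x - (AddCircle.equivIco 1 0 t : ℝ)⌉ : ℝ)) μ := by
  refine Integrable.of_bound (C := |x| + 2) ?_ (ae_of_all _ fun t => ?_)
  · have h : Measurable fun t : UnitAddCircle => ⌈x - (AddCircle.equivIco 1 0 t : ℝ)⌉ :=
      Int.measurable_ceil.comp (measurable_const.sub measurable_equivIco_coe)
    exact (measurable_from_top.comp h).aestronglyMeasurable
  · have h := (AddCircle.equivIco 1 0 t).2
    rw [Set.mem_Ico] at h
    have h1 := Int.le_ceil (x - (AddCircle.equivIco 1 0 t : ℝ))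
    have h2 := Int.ceil_lt_add_one (x - (AddCircle.equivIco 1 0 t : ℝ))
    rw [Real.norm_eq_abs, abs_le]
    constructor <;> linarith [neg_abs_le x, le_abs_self x]

theorem monotone_circleCdf : Monotone (circleCdf μ) := fun x y hxy =>
  integral_mono (integrable_ceil_sub_equivIco μ x) (integrable_ceil_sub_equivIco μ y) fun t => by
    have : ⌈x - (AddCircle.equivIco 1 0 t : ℝ)⌉ ≤ ⌈y - (AddCircle.equivIco 1 0 t : ℝ)⌉ :=
      Int.ceil_mono (by linarith)
    exact Int.cast_le.2 this

theorem circleCdf_add_int (x : ℝ) (n : ℤ) : circleCdf μ (x + n) = circleCdf μ x + n := by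
  have h : ∀ t : UnitAddCircle, (⌈x + n - (AddCircle.equivIco 1 0 t : ℝ)⌉ : ℝ)
      = ⌈x - (AddCircle.equivIco 1 0 t : ℝ)⌉ + n := fun t => by
    rw [add_sub_right_comm, Int.ceil_add_intCast]
    push_cast
    rfl
  simp only [circleCdf, h]
  rw [integral_add (integrable_ceil_sub_equivIco μ x) (integrable_const _)]
  simp

theorem circleCdf_sub (a b : ℝ) : circleCdf μ b - circleCdf μ a =
    ∫ t, ((⌈b - (AddCircle.equivIco 1 0 t : ℝ)⌉ : ℝ)
      - ⌈a - (AddCircle.equivIco 1 0 t : ℝ)⌉) ∂μ :=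
  (integral_sub (integrable_ceil_sub_equivIco μ b) (integrable_ceil_sub_equivIco μ a)).symm

/-- Two reals with the same image in `ℝ/ℤ` differ by an integer. -/
theorem exists_int_add_of_coe_eq {a b : ℝ} (h : (a : UnitAddCircle) = b) :
    ∃ n : ℤ, a = b + n := by
  rw [← sub_eq_zero, ← AddCircle.coe_sub, AddCircle.coe_eq_zero_iff] at h
  obtain ⟨n, hn⟩ := h
  refine ⟨n, ?_⟩
  simp only [zsmul_eq_mul, mul_one] at hn
  linarith

theorem ceil_sub_ceil_of_coe_eq {s t : ℝ} (h : (s : UnitAddCircle) = t) (a b : ℝ) :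
    ((⌈b - s⌉ : ℝ) - ⌈a - s⌉) = ⌈b - t⌉ - ⌈a - t⌉ := by
  obtain ⟨n, rfl⟩ := exists_int_add_of_coe_eq h
  rw [← sub_sub, ← sub_sub, Int.ceil_sub_intCast, Int.ceil_sub_intCast]
  push_cast
  ring

/-- Lifts of orientation preserving circle maps commute with integer translations. -/
theorem map_add_int_of_map_add_one {F : ℝ → ℝ} (hF : ∀ x, F (x + 1) = F x + 1) (x : ℝ) (n : ℤ) :
    F (x + n) = F x + n := by
  induction n using Int.induction_on with
  | zero => simp
  | succ n ih =>
    push_cast at ih ⊢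
    rw [← add_assoc, hF, ih]
    ring
  | pred n ih =>
    have := hF (x + (-n - 1 : ℤ))
    push_cast at ih this ⊢
    rw [show x + (-(n : ℝ) - 1) + 1 = x + -n by ring, ih] at this
    linarith

theorem ceil_map_sub_map {F : ℝ → ℝ} (hmono : StrictMono F) (hF : ∀ x, F (x + 1) = F x + 1)
    (a s : ℝ) : ⌈F a - F s⌉ = ⌈a - s⌉ := by
  have h1 := Int.le_ceil (a - s)
  have h2 := Int.ceil_lt_add_one (a - s)
  have h3 : F a ≤ F (s + (⌈a - s⌉ : ℤ)) := hmono.monotone (by linarith)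
  have h4 : F (s + (⌈a - s⌉ - 1 : ℤ)) < F a := hmono (by push_cast; linarith)
  rw [map_add_int_of_map_add_one hF] at h3 h4
  push_cast at h4
  rw [Int.ceil_eq_iff]
  constructor <;> linarith

variable {μ} in
/-- The lift of an orientation preserving homeomorphism preserving `μ` is conjugated to a
translation by the distribution function of `μ`. -/
theorem circleCdf_map_sub {f : UnitAddCircle ≃ₜ UnitAddCircle} (hf : Measure.map f μ = μ)
    {F : ℝ → ℝ} (hmono : StrictMono F) (hF : ∀ x, F (x + 1) = F x + 1)
    (hlift : ∀ x : ℝ, f (x : UnitAddCircle) = (F x : UnitAddCircle)) (a b : ℝ) :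
    circleCdf μ (F b) - circleCdf μ (F a) = circleCdf μ b - circleCdf μ a := by
  rw [circleCdf_sub, circleCdf_sub]
  conv_lhs => rw [← hf]
  rw [f.measurableEmbedding.integral_map]
  congr 1
  ext t
  have ht : ((AddCircle.equivIco 1 0 t : ℝ) : UnitAddCircle) = t :=
    (AddCircle.equivIco 1 0).symm_apply_apply t
  have hft : ((AddCircle.equivIco 1 0 (f t) : ℝ) : UnitAddCircle) = f t :=
    (AddCircle.equivIco 1 0).symm_apply_apply (f t)
  have h : ((AddCircle.equivIco 1 0 (f t) : ℝ) : UnitAddCircle)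
      = (F (AddCircle.equivIco 1 0 t : ℝ) : ℝ) := by
    rw [hft, ← hlift, ht]
  rw [ceil_sub_ceil_of_coe_eq h, ceil_map_sub_map hmono hF, ceil_map_sub_map hmono hF]

/-- The descent of `circleCdf` to a self-map of the circle. -/
noncomputable def circleCdfMap (t : UnitAddCircle) : UnitAddCircle :=
  (circleCdf μ (AddCircle.equivIco 1 0 t : ℝ) : UnitAddCircle)

theorem circleCdfMap_coe (x : ℝ) : circleCdfMap μ x = (circleCdf μ x : UnitAddCircle) := by
  have h : ((AddCircle.equivIco 1 0 (x : UnitAddCircle) : ℝ) : UnitAddCircle) = x :=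
    (AddCircle.equivIco 1 0).symm_apply_apply (x : UnitAddCircle)
  obtain ⟨n, hn⟩ := exists_int_add_of_coe_eq h
  rw [circleCdfMap, hn, circleCdf_add_int, AddCircle.coe_add]
  have : ((n : ℝ) : UnitAddCircle) = 0 := AddCircle.coe_eq_zero_iff 1 |>.2 ⟨n, by simp⟩
  rw [this, add_zero]

end TranslationNumber

section Orientation

/-- A `C¹` lift either preserves the orientation or is strictly decreasing. -/
theorem IsC1Lift.isOPC1Lift_or_strictAnti {f : UnitAddCircle ≃ₜ UnitAddCircle} {F : ℝ → ℝ}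
    (h : IsC1Lift f F) : IsOPC1Lift f F ∨ StrictAnti F := by
  obtain ⟨hC, hne, hper, hlift⟩ := h
  have hd : ∀ x ∈ Set.univ, HasDerivWithinAt F (deriv F x) Set.univ x := fun x _ =>
    ((hC.differentiable one_ne_zero) x).hasDerivAt.hasDerivWithinAt
  rcases hasDerivWithinAt_forall_lt_or_forall_gt_of_forall_ne convex_univ hd
    (fun x _ => hne x) with hneg | hpos
  · exact Or.inr (strictAnti_of_deriv_neg fun x => hneg x (Set.mem_univ x))
  · have hpos' : ∀ x, 0 < deriv F x := fun x => hpos x (Set.mem_univ x)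
    refine Or.inl ⟨hC, hpos', hper.resolve_right fun hper => ?_, hlift⟩
    have := strictMono_of_deriv_pos hpos' (show (0 : ℝ) < 0 + 1 by norm_num)
    rw [hper] at this
    linarith

theorem IsOPC1Lift.strictMono {f : UnitAddCircle ≃ₜ UnitAddCircle} {F : ℝ → ℝ}
    (h : IsOPC1Lift f F) : StrictMono F :=
  strictMono_of_deriv_pos h.2.1

/-- No circle map has both an increasing and a decreasing lift. -/
theorem not_strictMono_and_strictAnti_of_coe_eq {F F' : ℝ → ℝ} (hF : Continuous F)
    (hF' : Continuous F') (hmono : StrictMono F) (hanti : StrictAnti F')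
    (h : ∀ x, (F x : UnitAddCircle) = F' x) : False := by
  have hint : ∀ x, ∃ n : ℤ, F x - F' x = n := fun x => by
    obtain ⟨n, hn⟩ := exists_int_add_of_coe_eq (h x)
    exact ⟨n, by linarith⟩
  obtain ⟨m, hm⟩ := hint 0
  obtain ⟨n, hn⟩ := hint 1
  have hlt : (m : ℝ) < n := by
    have h1 := hmono (zero_lt_one' ℝ)
    have h2 := hanti (zero_lt_one' ℝ)
    linarith
  have hmn : (m : ℝ) + 1 ≤ n := by exact_mod_cast (Int.cast_lt.1 hlt)
  obtain ⟨x, hx⟩ := intermediate_value_univ 0 1 (hF.sub hF')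
    (show (m : ℝ) + 1 / 2 ∈ Set.Icc (F 0 - F' 0) (F 1 - F' 1) by
      rw [hm, hn]
      constructor <;> linarith)
  obtain ⟨k, hk⟩ := hint x
  have hk' : (k : ℝ) = m + 1 / 2 := by rw [← hk]; exact hx
  have h1 : m < k := by exact_mod_cast (show (m : ℝ) < k by linarith)
  have h2 : k < m + 1 := by exact_mod_cast (show (k : ℝ) < m + 1 by linarith)
  omega

variable {Γ : Type*} [Group Γ] {ρ : Γ →* (UnitAddCircle ≃ₜ UnitAddCircle)}

/-- The orientation character of a `C¹` action on the circle. -/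
theorem IsC1Action.exists_orientation_hom (hρ : IsC1Action ρ) :
    ∃ σ : Γ →* ℤˣ, ∀ γ ∈ σ.ker, ∃ F, IsOPC1Lift (ρ γ) F := by
  classical
  have hop : ∀ γ, (∃ F, IsOPC1Lift (ρ γ) F) ↔ ∃ F : ℝ → ℝ, Continuous F ∧ StrictMono F ∧
      ∀ x : ℝ, ρ γ (x : UnitAddCircle) = (F x : UnitAddCircle) := by
    refine fun γ => ⟨fun ⟨F, hF⟩ => ⟨F, hF.1.continuous, hF.strictMono, hF.2.2.2⟩, ?_⟩
    rintro ⟨F, hc, hm, hl⟩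
    obtain ⟨F', hF'⟩ := hρ γ
    exact ⟨F', hF'.isOPC1Lift_or_strictAnti.resolve_right fun ha =>
      not_strictMono_and_strictAnti_of_coe_eq hc hF'.1.continuous hm ha fun x => by
        rw [← hl, hF'.2.2.2]⟩
  have hnop : ∀ γ, (¬ ∃ F, IsOPC1Lift (ρ γ) F) ↔ ∃ F : ℝ → ℝ, Continuous F ∧ StrictAnti F ∧
      ∀ x : ℝ, ρ γ (x : UnitAddCircle) = (F x : UnitAddCircle) := by
    refine fun γ => ⟨fun h => ?_, ?_⟩
    · obtain ⟨F, hF⟩ := hρ γ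
      exact ⟨F, hF.1.continuous, hF.isOPC1Lift_or_strictAnti.resolve_left fun h' => h ⟨F, h'⟩,
        hF.2.2.2⟩
    · rintro ⟨F, hc, ha, hl⟩ ⟨F', hF'⟩
      exact not_strictMono_and_strictAnti_of_coe_eq hF'.1.continuous hc hF'.strictMono ha
        fun x => by rw [← hl, hF'.2.2.2]
  have hcomp : ∀ {γ δ : Γ} {F F' : ℝ → ℝ},
      (∀ x : ℝ, ρ γ (x : UnitAddCircle) = (F x : UnitAddCircle)) →
      (∀ x : ℝ, ρ δ (x : UnitAddCircle) = (F' x : UnitAddCircle)) →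
      ∀ x : ℝ, ρ (γ * δ) (x : UnitAddCircle) = ((F ∘ F') x : UnitAddCircle) := by
    intro γ δ F F' hF hF' x
    rw [map_mul]
    change ρ γ (ρ δ x) = _
    rw [hF', hF, Function.comp_apply]
  let σ : Γ → ℤˣ := fun γ => if ∃ F, IsOPC1Lift (ρ γ) F then 1 else -1
  refine ⟨MonoidHom.mk' σ fun γ δ => ?_, fun γ hγ => ?_⟩
  · by_cases hγ : ∃ F, IsOPC1Lift (ρ γ) F <;> by_cases hδ : ∃ F, IsOPC1Lift (ρ δ) F
    · obtain ⟨F, hc, hm, hl⟩ := (hop γ).1 hγ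
      obtain ⟨F', hc', hm', hl'⟩ := (hop δ).1 hδ
      have := (hop (γ * δ)).2 ⟨F ∘ F', hc.comp hc', hm.comp hm', hcomp hl hl'⟩
      simp only [σ, if_pos hγ, if_pos hδ, if_pos this, mul_one]
    · obtain ⟨F, hc, hm, hl⟩ := (hop γ).1 hγ
      obtain ⟨F', hc', hm', hl'⟩ := (hnop δ).1 hδ
      have := (hnop (γ * δ)).2 ⟨F ∘ F', hc.comp hc', hm.comp_strictAnti hm', hcomp hl hl'⟩
      simp only [σ, if_pos hγ, if_neg hδ, if_neg this, one_mul]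
    · obtain ⟨F, hc, hm, hl⟩ := (hnop γ).1 hγ
      obtain ⟨F', hc', hm', hl'⟩ := (hop δ).1 hδ
      have := (hnop (γ * δ)).2 ⟨F ∘ F', hc.comp hc', hm.comp_strictMono hm', hcomp hl hl'⟩
      simp only [σ, if_neg hγ, if_pos hδ, if_neg this, mul_one]
    · obtain ⟨F, hc, hm, hl⟩ := (hnop γ).1 hγ
      obtain ⟨F', hc', hm', hl'⟩ := (hnop δ).1 hδ
      have := (hop (γ * δ)).2 ⟨F ∘ F', hc.comp hc', hm.comp hm', hcomp hl hl'⟩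
      simp only [σ, if_neg hγ, if_neg hδ, if_pos this, neg_mul_neg, one_mul]
  · by_contra hno
    have h : σ γ = 1 := hγ
    simp only [σ, if_neg hno] at h
    exact absurd h (by decide)

end Orientation

section InvariantMeasure

variable {Γ : Type*} [Group Γ] {ρ : Γ →* (UnitAddCircle ≃ₜ UnitAddCircle)}
  {μ : Measure UnitAddCircle} [IsProbabilityMeasure μ]

variable (μ) in
/-- The translation numbers with respect to an invariant measure form a homomorphism to the
circle, whose kernel consists of elements with lifts that preserve the distribution function. -/
theorem exists_translation_hom (hρ : ∀ γ, ∃ F, IsOPC1Lift (ρ γ) F)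
    (hinv : ∀ γ, Measure.map (ρ γ) μ = μ) :
    ∃ α : Γ →* Multiplicative UnitAddCircle, ∀ γ ∈ α.ker,
      ∃ F, IsOPC1Lift (ρ γ) F ∧ ∀ x, circleCdf μ (F x) = circleCdf μ x := by
  set h := circleCdfMap μ
  have hconst : ∀ γ t, h (ρ γ t) - h t = h (ρ γ 0) - h 0 := by
    intro γ t
    obtain ⟨F, hF⟩ := hρ γ
    obtain ⟨x, rfl⟩ : ∃ x : ℝ, (x : UnitAddCircle) = t := QuotientAddGroup.mk_surjective t
    have h0 := circleCdf_map_sub (hinv γ) hF.strictMono hF.2.2.1 hF.2.2.2 0 x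
    rw [show (0 : UnitAddCircle) = ((0 : ℝ) : UnitAddCircle) from rfl, hF.2.2.2, hF.2.2.2]
    simp only [h, circleCdfMap_coe, ← AddCircle.coe_sub]
    congr 1
    linarith
  refine ⟨MonoidHom.mk' (fun γ => Multiplicative.ofAdd (h (ρ γ 0) - h 0)) fun γ δ => ?_,
    fun γ hγ => ?_⟩
  · rw [← ofAdd_add, map_mul]
    congr 1
    change h (ρ γ (ρ δ 0)) - h 0 = _
    rw [← hconst γ (ρ δ 0)]
    abel
  · obtain ⟨F, hF⟩ := hρ γ
    have h0 : h (ρ γ ((0 : ℝ) : UnitAddCircle)) = h ((0 : ℝ) : UnitAddCircle) := sub_eq_zero.1 hγ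
    rw [hF.2.2.2] at h0
    simp only [h, circleCdfMap_coe] at h0
    obtain ⟨n, hn⟩ := exists_int_add_of_coe_eq h0
    refine ⟨fun x => F x - n, ⟨hF.1.sub contDiff_const, fun x => ?_, fun x => ?_, fun x => ?_⟩,
      fun x => ?_⟩
    · rw [deriv_sub_const]
      exact hF.2.1 x
    · have h1 := hF.2.2.1 x
      dsimp only
      linarith
    · rw [hF.2.2.2, AddCircle.coe_sub]
      have : ((n : ℝ) : UnitAddCircle) = 0 := AddCircle.coe_eq_zero_iff 1 |>.2 ⟨n, by simp⟩
      rw [this, sub_zero]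
    · have h1 := circleCdf_map_sub (hinv γ) hF.strictMono hF.2.2.1 hF.2.2.2 0 x
      have h2 := circleCdf_add_int μ (F x - n) n
      rw [sub_add_cancel] at h2
      linarith

/-- The distribution function has a point of strict increase on one side. -/
theorem exists_strict_increase_circleCdf :
    ∃ x, (∀ y < x, circleCdf μ y < circleCdf μ x) ∨ ∀ y > x, circleCdf μ x < circleCdf μ y := by
  have hper := circleCdf_add_int μ 0
  set S : Set ℝ := {y | circleCdf μ 0 ≤ circleCdf μ y}
  have hne : S.Nonempty := ⟨0, le_refl (circleCdf μ 0)⟩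
  have hbdd : BddBelow S := by
    refine ⟨-1, fun y hy => le_of_not_gt fun hlt => ?_⟩
    have h1 := monotone_circleCdf μ hlt.le
    have h2 := hper (-1)
    push_cast at h2
    rw [zero_add] at h2
    have h3 : circleCdf μ 0 ≤ circleCdf μ y := hy
    linarith
  refine ⟨sInf S, ?_⟩
  by_cases hmem : sInf S ∈ S
  · exact Or.inl fun y hy => (lt_of_not_ge fun h => notMem_of_lt_csInf hy hbdd h).trans_le hmem
  · refine Or.inr fun y hy => ?_
    obtain ⟨z, hz, hzy⟩ := exists_lt_of_csInf_lt hne hy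
    exact (lt_of_not_ge hmem).trans_le (le_trans hz (monotone_circleCdf μ hzy.le))

/-- A finitely generated group without nontrivial homomorphisms to the reals acting by `C¹`
diffeomorphisms of zero translation number acts trivially. -/
theorem eq_one_of_circleCdf_map_eq [Group.FG Γ] (hhom : ∀ φ : Γ →* Multiplicative ℝ, φ = 1)
    (hρ : ∀ γ, ∃ F, IsOPC1Lift (ρ γ) F ∧ ∀ x, circleCdf μ (F x) = circleCdf μ x) (γ : Γ) :
    ρ γ = 1 := by
  choose F hF hcdf using hρ
  have huniq : ∀ a b : ℝ, (a : UnitAddCircle) = b → circleCdf μ a = circleCdf μ b → a = b := by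
    intro a b hab h
    obtain ⟨n, rfl⟩ := exists_int_add_of_coe_eq hab
    rw [circleCdf_add_int] at h
    linarith
  have hone : ∀ x, F 1 x = x := fun x =>
    huniq _ _ (by rw [← (hF 1).2.2.2, map_one]; rfl) (hcdf 1 x)
  have hmul : ∀ γ δ x, F (γ * δ) x = F γ (F δ x) := fun γ δ x =>
    huniq _ _ (by rw [← (hF _).2.2.2, ← (hF γ).2.2.2, ← (hF δ).2.2.2, map_mul]; rfl)
      (by rw [hcdf, hcdf, hcdf])
  have hinv : ∀ γ x, F γ⁻¹ (F γ x) = x := fun γ x => by rw [← hmul, inv_mul_cancel, hone]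
  obtain ⟨x₀, hx₀⟩ := exists_strict_increase_circleCdf (μ := μ)
  have hfix : ∀ γ, F γ x₀ = x₀ := by
    intro γ
    rcases hx₀ with hx₀ | hx₀
    · have hle : ∀ γ, x₀ ≤ F γ x₀ := fun γ => le_of_not_gt fun h => (hx₀ _ h).ne (hcdf γ x₀)
      refine le_antisymm (le_of_not_gt fun h => ?_) (hle γ)
      have := (hF γ⁻¹).strictMono h
      rw [hinv] at this
      exact this.not_ge (hle γ⁻¹)
    · have hle : ∀ γ, F γ x₀ ≤ x₀ := fun γ => le_of_not_gt fun h => (hx₀ _ h).ne' (hcdf γ x₀)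
      refine le_antisymm (hle γ) (le_of_not_gt fun h => ?_)
      have := (hF γ⁻¹).strictMono h
      rw [hinv] at this
      exact this.not_ge (hle γ⁻¹)
  ext t
  obtain ⟨x, rfl⟩ : ∃ x : ℝ, (x : UnitAddCircle) = t := QuotientAddGroup.mk_surjective t
  rw [(hF γ).2.2.2, eq_self_of_C1_of_common_fixed_point hhom hone hmul (fun γ => (hF γ).1)
    (fun γ => (hF γ).2.1) hfix]
  rfl

end InvariantMeasure

/-- **(Case 1 of the second main theorem.)** Let `G` be a finitely generated
group all of whose finite-index normal subgroups have only the trivial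
homomorphism to `(ℝ,+)`. Then any `C¹` action of `G` on the circle preserving a
Borel probability measure factors through a finite group. -/
theorem finite_index_kernel_of_measure_preserving_C1
    {G : Type*} [Group G] (hfg : Group.FG G)
    (hcoh : ∀ G₀ : Subgroup G, G₀.Normal → G₀.FiniteIndex →
      ∀ φ : G₀ →* Multiplicative ℝ, φ = 1)
    (ρ : G →* (UnitAddCircle ≃ₜ UnitAddCircle))
    (hρ : IsC1Action ρ)
    (μ : Measure UnitAddCircle) [IsProbabilityMeasure μ]
    (hinv : ∀ g : G, Measure.map (ρ g) μ = μ) :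
    (MonoidHom.ker ρ).FiniteIndex := by
  obtain ⟨σ, hσ⟩ := hρ.exists_orientation_hom
  have hhom := fun (H : Subgroup G) (_ : H.FiniteIndex) => hom_real_eq_one_of_forall_normal hcoh H
  obtain ⟨α, hα⟩ := exists_translation_hom (ρ := ρ.comp σ.ker.subtype) μ
    (fun γ => hσ γ γ.2) (fun γ => hinv γ)
  have : Finite α.range := finite_range_of_hom_real_eq_one (hhom σ.ker inferInstance) α
  have hindex : (α.ker.map σ.ker.subtype).FiniteIndex := ⟨by
    rw [Subgroup.index_map_subtype]
    exact mul_ne_zero Subgroup.FiniteIndex.index_ne_zero Subgroup.FiniteIndex.index_ne_zero⟩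
  have hhomα : ∀ φ : α.ker →* Multiplicative ℝ, φ = 1 := fun φ => by
    let e := α.ker.equivMapOfInjective σ.ker.subtype σ.ker.subtype_injective
    ext γ
    simpa using DFunLike.congr_fun (hhom _ hindex (φ.comp e.symm.toMonoidHom)) (e γ)
  have htriv := eq_one_of_circleCdf_map_eq (μ := μ)
    (ρ := (ρ.comp σ.ker.subtype).comp α.ker.subtype) hhomα fun γ => hα γ γ.2
  refine Subgroup.finiteIndex_of_le (H := α.ker.map σ.ker.subtype) ?_
  rintro _ ⟨γ, hγ, rfl⟩
  exact htriv ⟨γ, hγ⟩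
end

section
/- Let n ≥ 1 and for each 1 ≤ i ≤ n let G_i be a finitely generated group with trivial abelianization (H₁(G_i,ℤ) = 0). Then for any C¹ action ρ of the direct product G₁ × G₂ × ⋯ × G_n on the circle, there is at most one index i whose factor acts nontrivially: for all indices i ≠ j, either ρ applied to every element supported in the i-th factor (i.e. equal to the identity in all other coordinates) is the identity homeomorphism, or the same holds for the j-th factor. -/
open MeasureTheory

open scoped commutatorElement

section ThurstonStability

open Filter Topology Asymptotics

theorem Group.IsPerfect.map_eq_one {A H : Type*} [Group A] [Group.IsPerfect A] [CommGroup H]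
    (φ : A →* H) (a : A) : φ a = 1 :=
  Abelianization.commutator_subset_ker φ Group.IsPerfect.mem_commutator

variable {A : Type*} [Group A] [MulAction A ℝ]

theorem hasStrictDerivAt_one_of_isPerfect [Group.IsPerfect A]
    (hC : ∀ a : A, ContDiff ℝ 1 fun x : ℝ => a • x) {q : ℝ} (hq : ∀ a : A, a • q = q) (a : A) :
    HasStrictDerivAt (fun x : ℝ => a • x) 1 q := by
  have hd : ∀ a : A, HasStrictDerivAt (fun x : ℝ => a • x) (deriv (fun x : ℝ => a • x) q) q :=
    fun a => (hC a).hasStrictDerivAt one_ne_zero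
  let φ : A →* ℝ :=
    { toFun := fun a => deriv (fun x : ℝ => a • x) q
      map_one' := by simp
      map_mul' := fun a b => by
        have h := (hd a).hasDerivAt
        rw [← hq b] at h
        have := h.comp q (hd b).hasDerivAt
        simp only [hq] at this
        rw [← this.deriv]
        congr 1
        ext x
        exact mul_smul a b x }
  have h1 : deriv (fun x : ℝ => a • x) q = 1 :=
    congrArg Units.val (Group.IsPerfect.map_eq_one φ.toHomUnits a)
  rw [← h1]
  exact hd a

theorem isLittleO_smul_smul_sub_smul {q : ℝ} {l : Filter ℝ} (hl : l ≤ 𝓝 q) {a b : A}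
    (hq : b • q = q)
    (ha : HasStrictDerivAt (fun x : ℝ => a • x) 1 q) (hb : Continuous fun x : ℝ => b • x) :
    (fun x : ℝ => ((a * b) • x - x) - ((a • x - x) + (b • x - x))) =o[l] fun x => b • x - x := by
  have h1 := hasStrictDerivAt_iff_hasStrictFDerivAt.1 ha |>.isLittleO
  have ht : Tendsto (fun x : ℝ => (b • x, x)) l (𝓝 (q, q)) := by
    rw [nhds_prod_eq]
    refine Tendsto.prodMk ?_ hl
    have := hb.tendsto q
    rw [hq] at this
    exact this.mono_left hl
  refine (h1.comp_tendsto ht).congr_left fun x => ?_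
  simp [mul_smul]
  ring

/-- **Thurston stability** on the line: a finitely generated perfect group acting on `ℝ` by
`C¹` maps with a global fixed point acts trivially. -/
theorem smul_eq_self_of_isPerfect_of_fg [Group.IsPerfect A] [Group.FG A]
    (hC : ∀ a : A, ContDiff ℝ 1 fun x : ℝ => a • x) {p : ℝ} (hp : ∀ a : A, a • p = p)
    (a : A) (x : ℝ) : a • x = x := by
  obtain ⟨S, hS, hSfin⟩ := Monoid.fg_iff.1 (Group.fg_iff_monoid_fg.1 ‹Group.FG A›)
  lift S to Finset A using hSfin
  set F : Set ℝ := MulAction.fixedPoints A ℝ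
  suffices h : F = Set.univ from (h ▸ Set.mem_univ x : x ∈ F) a
  by_contra hF
  have hFc : IsClosed F := by
    have : F = ⋂ a : A, {x : ℝ | a • x = x} := by ext; simp [F]
    rw [this]
    exact isClosed_iInter fun a => isClosed_eq (hC a).continuous continuous_id
  obtain ⟨q, hqF⟩ := nonempty_frontier_iff.2 ⟨(⟨p, hp⟩ : F.Nonempty), hF⟩
  have hq : ∀ a : A, a • q = q := hFc.frontier_subset hqF
  have hne : (𝓝[Fᶜ] q).NeBot := mem_closure_iff_nhdsWithin_neBot.1
    (frontier_compl F ▸ hqF : q ∈ frontier Fᶜ).1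
  set u : ℝ → ℝ := fun x => ∑ s ∈ S, |s • x - x|
  have hu : ∀ᶠ x in 𝓝[Fᶜ] q, u x ≠ 0 := by
    filter_upwards [self_mem_nhdsWithin] with x hx h0
    refine hx ?_
    rw [Finset.sum_eq_zero_iff_of_nonneg fun _ _ => abs_nonneg _] at h0
    have : Submonoid.closure (S : Set A) ≤ MulAction.stabilizerSubmonoid A x :=
      (Submonoid.closure_le).2 fun s hs => by simpa [sub_eq_zero] using h0 s hs
    rw [hS] at this
    exact fun a => this (Submonoid.mem_top a)
  have hdef : ∀ a b : A, (fun x : ℝ => ((a * b) • x - x) - ((a • x - x) + (b • x - x)))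
      =o[𝓝[Fᶜ] q] fun x => b • x - x := fun a b =>
    isLittleO_smul_smul_sub_smul nhdsWithin_le_nhds (hq b)
      (hasStrictDerivAt_one_of_isPerfect hC hq a) (hC b).continuous
  have hO : ∀ a : A, (fun x : ℝ => a • x - x) =O[𝓝[Fᶜ] q] u := by
    intro a
    have ha : a ∈ Submonoid.closure (S : Set A) := hS ▸ Submonoid.mem_top a
    induction ha using Submonoid.closure_induction with
    | mem s hs =>
      refine IsBigO.of_bound 1 (Eventually.of_forall fun x => ?_)
      rw [one_mul, Real.norm_eq_abs, Real.norm_eq_abs]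
      exact (Finset.single_le_sum (f := fun s : A => |s • x - x|) (fun _ _ => abs_nonneg _)
        hs).trans (le_abs_self _)
    | one => simpa using isBigO_zero _ _
    | mul a b _ _ ha hb =>
      refine (((hdef a b).isBigO.trans hb).add (ha.add hb)).congr_left fun x => ?_
      ring
  set U := Ultrafilter.of (𝓝[Fᶜ] q)
  have hU : (U : Filter ℝ) ≤ 𝓝[Fᶜ] q := Ultrafilter.of_le _
  have hlim : ∀ a : A, ∃ c : ℝ, Tendsto (fun x : ℝ => (a • x - x) / u x) U (𝓝 c) := by
    intro a
    obtain ⟨C, hC⟩ := (hO a).bound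
    have hmem : ∀ᶠ x in (U : Filter ℝ), (a • x - x) / u x ∈ Set.Icc (-C) C := by
      filter_upwards [hU hC, hU hu] with x hx hux
      rw [Set.mem_Icc, ← abs_le, abs_div, div_le_iff₀ (abs_pos.2 hux)]
      exact hx
    obtain ⟨c, -, hc⟩ := isCompact_Icc.ultrafilter_le_nhds' (U.map fun x => (a • x - x) / u x) hmem
    exact ⟨c, hc⟩
  choose φ hφ using hlim
  have hadd : ∀ a b, φ (a * b) = φ a + φ b := by
    intro a b
    refine sub_eq_zero.1 (tendsto_nhds_unique
      (((hφ (a * b)).sub ((hφ a).add (hφ b)))) ?_)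
    refine ((((hdef a b).trans_isBigO (hO b)).mono hU).tendsto_div_nhds_zero).congr fun x => ?_
    ring
  let ψ : A →* Multiplicative ℝ :=
    { toFun := fun a => Multiplicative.ofAdd (φ a)
      map_one' := by
        have := hadd 1 1
        rw [mul_one] at this
        rw [left_eq_add.1 this, ofAdd_zero]
      map_mul' := fun a b => by rw [hadd, ofAdd_add] }
  have hzero : ∀ a, φ a = 0 := fun a => Group.IsPerfect.map_eq_one ψ a
  have hsum : Tendsto (fun x => ∑ s ∈ S, |(s • x - x) / u x|) U (𝓝 (∑ s ∈ S, |φ s|)) :=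
    tendsto_finsetSum _ fun s _ => (hφ s).abs
  have hone : Tendsto (fun x => ∑ s ∈ S, |(s • x - x) / u x|) U (𝓝 1) := by
    refine tendsto_const_nhds.congr' ?_
    filter_upwards [hU hu] with x hx
    have hpos : 0 ≤ u x := Finset.sum_nonneg fun _ _ => abs_nonneg _
    simp_rw [abs_div, abs_of_nonneg hpos]
    rw [← Finset.sum_div, div_self hx]
  have := tendsto_nhds_unique hsum hone
  simp [hzero] at this

end ThurstonStability

namespace CircleDeg1Lift

theorem abs_map_sub_self_sub_translationNumber_le (g : CircleDeg1Lift) (x : ℝ) :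
    |g x - x - translationNumber g| ≤ 1 := by
  have h1 := g.floor_sub_le_translationNumber x
  have h2 := g.translationNumber_le_ceil_sub x
  have h3 := Int.lt_floor_add_one (g x - x)
  have h4 := Int.ceil_lt_add_one (g x - x)
  rw [abs_le]
  constructor <;> linarith

section Iterates

variable {f h : CircleDeg1Lift} {K : Set ℝ}

theorem pow_mapsTo (hf : ∀ x ∈ K, f x ∈ K) (n : ℕ) : ∀ x ∈ K, (f ^ n) x ∈ K := by
  induction n with
  | zero => simp
  | succ n ih =>
    intro x hx
    rw [pow_succ', mul_apply]
    exact hf _ (ih x hx)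

theorem map_pow_le_pow_map (hh : ∀ x ∈ K, h x ∈ K) (H : ∀ x ∈ K, f (h x) ≤ h (f x)) (n : ℕ) :
    ∀ x ∈ K, f ((h ^ n) x) ≤ (h ^ n) (f x) := by
  induction n with
  | zero => simp
  | succ n ih =>
    intro x hx
    rw [pow_succ', mul_apply, mul_apply]
    exact (H _ (pow_mapsTo hh n x hx)).trans (h.monotone (ih x hx))

theorem pow_map_le_map_pow (hf : ∀ x ∈ K, f x ∈ K) (H : ∀ x ∈ K, f (h x) ≤ h (f x)) (n : ℕ) :
    ∀ x ∈ K, (f ^ n) (h x) ≤ h ((f ^ n) x) := by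
  induction n with
  | zero => simp
  | succ n ih =>
    intro x hx
    rw [pow_succ', mul_apply, mul_apply]
    exact (f.monotone (ih x hx)).trans (H _ (pow_mapsTo hf n x hx))

theorem pow_pow_le_mul_pow (hf : ∀ x ∈ K, f x ∈ K) (hh : ∀ x ∈ K, h x ∈ K)
    (H : ∀ x ∈ K, f (h x) ≤ h (f x)) (n : ℕ) :
    ∀ x ∈ K, (f ^ n) ((h ^ n) x) ≤ ((f * h) ^ n) x := by
  induction n with
  | zero => simp
  | succ n ih =>
    intro x hx
    simp only [pow_succ', mul_apply]
    exact f.monotone ((pow_map_le_map_pow hf H n _ (pow_mapsTo hh n x hx)).trans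
      (h.monotone (ih x hx)))

theorem mul_pow_le_pow_pow (hf : ∀ x ∈ K, f x ∈ K) (hh : ∀ x ∈ K, h x ∈ K)
    (H : ∀ x ∈ K, f (h x) ≤ h (f x)) (n : ℕ) :
    ∀ x ∈ K, ((f * h) ^ n) x ≤ (h ^ n) ((f ^ n) x) := by
  induction n with
  | zero => simp
  | succ n ih =>
    intro x hx
    have h1 := map_pow_le_pow_map hh H (n + 1) _ (pow_mapsTo hf n x hx)
    rw [pow_succ' (f * h), mul_apply, pow_succ' f, mul_apply f]
    refine le_trans ?_ h1
    rw [pow_succ' h, mul_apply]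
    exact f.monotone (h.monotone (ih x hx))

theorem translationNumber_mul_of_map_le {x : ℝ} (hx : x ∈ K)
    (hf : ∀ x ∈ K, f x ∈ K) (hh : ∀ x ∈ K, h x ∈ K) (H : ∀ x ∈ K, f (h x) ≤ h (f x)) :
    translationNumber (f * h) = translationNumber f + translationNumber h := by
  have key : ∀ n : ℕ,
      n * |translationNumber (f * h) - (translationNumber f + translationNumber h)| ≤ 3 := by
    intro n
    have h1 := pow_pow_le_mul_pow hf hh H n x hx
    have h2 := mul_pow_le_pow_pow hf hh H n x hx
    have e1 := abs_le.1 (abs_map_sub_self_sub_translationNumber_le (h ^ n) x)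
    have e2 := abs_le.1 (abs_map_sub_self_sub_translationNumber_le (f ^ n) ((h ^ n) x))
    have e3 := abs_le.1 (abs_map_sub_self_sub_translationNumber_le (f ^ n) x)
    have e4 := abs_le.1 (abs_map_sub_self_sub_translationNumber_le (h ^ n) ((f ^ n) x))
    have e5 := abs_le.1 (abs_map_sub_self_sub_translationNumber_le ((f * h) ^ n) x)
    rw [translationNumber_pow] at e1 e2 e3 e4 e5
    rw [← Nat.abs_cast n, ← abs_mul, abs_le]
    constructor <;> linarith [e1.1, e1.2, e2.1, e2.2, e3.1, e3.2, e4.1, e4.2, e5.1, e5.2]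
  by_contra hne
  have hpos := abs_pos.2 (sub_ne_zero.2 hne)
  obtain ⟨n, hn⟩ := exists_lt_nsmul hpos 3
  rw [nsmul_eq_mul] at hn
  exact (key n).not_gt hn

end Iterates

/-- A nonempty closed subset of `ℝ` invariant under a group of lifts of circle homeomorphisms. -/
structure IsClosedInvariant (Γ : Subgroup CircleDeg1Liftˣ) (K : Set ℝ) : Prop where
  isClosed : IsClosed K
  nonempty : K.Nonempty
  map_mem : ∀ γ ∈ Γ, ∀ x ∈ K, γ x ∈ K

theorem units_continuous (u : CircleDeg1Liftˣ) : Continuous u :=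
  (toOrderIso u).continuous

theorem units_strictMono (u : CircleDeg1Liftˣ) : StrictMono u :=
  (toOrderIso u).strictMono

theorem units_mul_apply (u v : CircleDeg1Liftˣ) (x : ℝ) : (u * v) x = u (v x) := rfl

theorem units_inv_apply_le_iff (u : CircleDeg1Liftˣ) {x y : ℝ} :
    (u⁻¹ : CircleDeg1Liftˣ) x ≤ y ↔ x ≤ u y := by
  rw [← (units_strictMono u).le_iff_le, units_apply_inv_apply]

variable {Γ Δ : Subgroup CircleDeg1Liftˣ} {K L : Set ℝ}

/-- The subgroup of integer translations. -/
def intTranslations : Subgroup CircleDeg1Liftˣ :=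
  (translate.comp (AddMonoidHom.toMultiplicative (Int.castAddHom ℝ))).range

theorem translate_int_mem (hT : intTranslations ≤ Γ) (n : ℤ) :
    translate (Multiplicative.ofAdd (n : ℝ)) ∈ Γ :=
  hT ⟨Multiplicative.ofAdd n, rfl⟩

theorem IsClosedInvariant.add_int_mem (hK : IsClosedInvariant Γ K) (hT : intTranslations ≤ Γ)
    {x : ℝ} (hx : x ∈ K) (n : ℤ) : x + n ∈ K := by
  have := hK.map_mem _ (translate_int_mem hT n) x hx
  rwa [translate_apply, add_comm] at this

theorem commutator_apply_eq_self (hT : intTranslations ≤ Γ) (hK : IsClosedInvariant Γ K)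
    (hcmp : ∀ γ ∈ Γ, ∀ x ∈ K, ∀ y ∈ K, γ x ≤ x → γ y ≤ y) {f h : CircleDeg1Liftˣ}
    (hf : f ∈ Γ) (hh : h ∈ Γ) {x : ℝ} (hx : x ∈ K) : ⁅f, h⁆ x = x := by
  have hcmp' : ∀ a ∈ Γ, ∀ b ∈ Γ, ∀ x ∈ K, ∀ y ∈ K, a x ≤ b x → a y ≤ b y := by
    intro a ha b hb x hx y hy hab
    have := hcmp (b⁻¹ * a) (Γ.mul_mem (Γ.inv_mem hb) ha) x hx y hy
    simp only [units_mul_apply, units_inv_apply_le_iff] at this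
    exact this hab
  have hadd : ∀ a ∈ Γ, ∀ b ∈ Γ, translationNumber (↑(a * b) : CircleDeg1Lift) =
      translationNumber (a : CircleDeg1Lift) + translationNumber (b : CircleDeg1Lift) := by
    intro a ha b hb
    rcases le_total (a (b x)) (b (a x)) with h1 | h1
    · exact translationNumber_mul_of_map_le hx (hK.map_mem a ha) (hK.map_mem b hb)
        fun y hy => hcmp' (a * b) (Γ.mul_mem ha hb) (b * a) (Γ.mul_mem hb ha) x hx y hy h1
    · have h2 := translationNumber_mul_of_map_le hx (hK.map_mem b hb) (hK.map_mem a ha)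
        fun y hy => hcmp' (b * a) (Γ.mul_mem hb ha) (a * b) (Γ.mul_mem ha hb) x hx y hy h1
      have h3 := translationNumber_conj_eq b (a * b : CircleDeg1Lift)
      rw [Units.val_mul, ← h3, ← mul_assoc, mul_assoc (_ * _), ← Units.val_mul b b⁻¹,
        mul_inv_cancel, Units.val_one, mul_one, h2, add_comm]
  have hc : ⁅f, h⁆ ∈ Γ :=
    Γ.mul_mem (Γ.mul_mem (Γ.mul_mem hf hh) (Γ.inv_mem hf)) (Γ.inv_mem hh)
  have hτ : translationNumber (↑⁅f, h⁆ : CircleDeg1Lift) = ((0 : ℤ) : ℝ) := by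
    have : ⁅f, h⁆ = (f * h) * (h * f)⁻¹ := by rw [commutatorElement_def]; group
    rw [this, hadd _ (Γ.mul_mem hf hh) _ (Γ.inv_mem (Γ.mul_mem hh hf)),
      translationNumber_units_inv, hadd _ hf _ hh, hadd _ hh _ hf]
    rw [Int.cast_zero]
    ring
  obtain ⟨p, hp⟩ := (translationNumber_eq_int_iff _ (units_continuous _)).1 hτ
  generalize ⁅f, h⁆ = c at *
  rw [Int.cast_zero, add_zero] at hp
  have hp' : (c⁻¹ : CircleDeg1Liftˣ) p = p := by
    conv_lhs => rw [← hp]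
    exact units_inv_apply_apply c p
  -- the largest point of `K` below `p` is fixed by `c`
  have hne : (K ∩ Set.Iic p).Nonempty := by
    refine ⟨x + (⌊p - x⌋ : ℤ), hK.add_int_mem hT hx _, ?_⟩
    have := Int.floor_le (p - x)
    simp only [Set.mem_Iic]; linarith
  have hbdd : BddAbove (K ∩ Set.Iic p) := ⟨p, fun y hy => hy.2⟩
  have hy := (hK.isClosed.inter isClosed_Iic).csSup_mem hne hbdd
  set y := sSup (K ∩ Set.Iic p)
  have hle : ∀ g ∈ Γ, g p = p → g y ≤ y := fun g hg hgp =>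
    le_csSup hbdd ⟨hK.map_mem g hg y hy.1, by
      have := (units_strictMono g).monotone hy.2
      rwa [hgp] at this⟩
  have h1 := hle c hc hp
  have h2 := hle c⁻¹ (Γ.inv_mem hc) hp'
  refine le_antisymm (hcmp c hc y hy.1 x hx h1) ?_
  have := hcmp c⁻¹ (Γ.inv_mem hc) y hy.1 x hx h2
  rwa [units_inv_apply_le_iff] at this

theorem exists_minimal_isClosedInvariant (hT : intTranslations ≤ Γ) :
    ∃ K, IsClosedInvariant Γ K ∧ ∀ L, IsClosedInvariant Γ L → L ⊆ K → K ⊆ L := by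
  obtain ⟨K, -, hK⟩ := zorn_superset_nonempty {K | IsClosedInvariant Γ K} (by
    intro c hc hchain hne
    refine ⟨⋂₀ c, ⟨isClosed_sInter fun s hs => (hc hs).isClosed, ?_, ?_⟩,
      fun s hs => Set.sInter_subset_of_mem hs⟩
    · have : Nonempty c := hne.to_subtype
      obtain ⟨x, hx⟩ := IsCompact.nonempty_iInter_of_directed_nonempty_isCompact_isClosed
        (fun s : c => (s : Set ℝ) ∩ Set.Icc 0 1)
        (by
          intro s t
          rcases hchain.total s.2 t.2 with h | h
          · exact ⟨s, subset_rfl, Set.inter_subset_inter_left _ h⟩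
          · exact ⟨t, Set.inter_subset_inter_left _ h, subset_rfl⟩)
        (by
          intro s
          obtain ⟨x, hx⟩ := (hc s.2).nonempty
          refine ⟨x + (-⌊x⌋ : ℤ), (hc s.2).add_int_mem hT hx _, ?_⟩
          have h1 := Int.floor_le x
          have h2 := Int.lt_floor_add_one x
          push_cast
          constructor <;> linarith)
        (fun s => isCompact_Icc.inter_left (hc s.2).isClosed)
        (fun s => (hc s.2).isClosed.inter isClosed_Icc)
      exact ⟨x, fun s hs => (Set.mem_iInter.1 hx ⟨s, hs⟩).1⟩
    · exact fun γ hγ x hx s hs => (hc hs).map_mem γ hγ x (hx s hs))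
    Set.univ ⟨isClosed_univ, Set.univ_nonempty, fun _ _ _ _ => trivial⟩
  exact ⟨K, hK.prop, fun L hL hLK => hK.le_of_le hL hLK⟩

theorem IsClosedInvariant.image (hK : IsClosedInvariant Γ K) {δ : CircleDeg1Liftˣ}
    (hδ : ∀ γ ∈ Γ, Commute γ δ) : IsClosedInvariant Γ (δ '' K) where
  isClosed := (toOrderIso δ).toHomeomorph.isClosedMap K hK.isClosed
  nonempty := hK.nonempty.image _
  map_mem := by
    rintro γ hγ _ ⟨x, hx, rfl⟩
    refine ⟨γ x, hK.map_mem γ hγ x hx, ?_⟩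
    rw [← units_mul_apply, ← units_mul_apply, (hδ γ hγ).eq]

/-- The points of `L` immediately to the right of a point of `K`. -/
def rightNeighbors (K L : Set ℝ) : Set ℝ :=
  {y | y ∈ L ∧ ∃ x ∈ K, x < y ∧ ∀ z ∈ L, x < z → y ≤ z}

theorem exists_rightNeighbors_subsingleton_near (hK : IsClosed K) (hL : IsClosed L)
    (hKL : Disjoint K L) (y : ℝ) :
    ∃ ε > 0, ∀ a ∈ rightNeighbors K L, ∀ b ∈ rightNeighbors K L,
      |a - y| < ε → |b - y| < ε → a = b := by
  by_cases hy : y ∈ K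
  · have : y ∈ Lᶜ := fun h => hKL.le_bot ⟨hy, h⟩
    obtain ⟨ε, hε, hb⟩ := Metric.isOpen_iff.1 hL.isOpen_compl y this
    exact ⟨ε, hε, fun a ha _ _ h _ => absurd ha.1 (hb h)⟩
  · obtain ⟨ε, hε, hb⟩ := Metric.isOpen_iff.1 hK.isOpen_compl y hy
    have key : ∀ a ∈ rightNeighbors K L, ∀ b ∈ rightNeighbors K L,
        |a - y| < ε → |b - y| < ε → b ≤ a := by
      intro a ha b hb' hay hby
      obtain ⟨x, hx, hxb, hxL⟩ := hb'.2
      by_contra! hab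
      have hax : a ≤ x := by
        by_contra! h
        exact hab.not_ge (hxL a ha.1 h)
      refine hb (a := x) ?_ hx
      rw [Metric.mem_ball, Real.dist_eq]
      rw [abs_lt] at *
      constructor <;> linarith
    exact ⟨ε, hε, fun a ha b hb h1 h2 => le_antisymm (key b hb a ha h2 h1) (key a ha b hb h1 h2)⟩

/-- A nonempty bounded below subset of a closed discrete set of reals has a least element. -/
theorem exists_isLeast_of_subsingleton_near {D : Set ℝ}
    (hD : ∀ y, ∃ ε > 0, ∀ a ∈ D, ∀ b ∈ D, |a - y| < ε → |b - y| < ε → a = b)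
    {S : Set ℝ} (hSD : S ⊆ D) (hne : S.Nonempty) (hb : BddBelow S) : ∃ m, IsLeast S m := by
  obtain ⟨ε, hε, h⟩ := hD (sInf S)
  obtain ⟨z, hz, hzlt⟩ := Real.lt_sInf_add_pos hne hε
  refine ⟨z, hz, fun w hw => ?_⟩
  by_contra! hwz
  have h1 := csInf_le hb hz
  have h2 := csInf_le hb hw
  have := h z (hSD hz) w (hSD hw) (by rw [abs_lt]; constructor <;> linarith)
    (by rw [abs_lt]; constructor <;> linarith)
  linarith

theorem isClosed_of_subsingleton_near {D : Set ℝ}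
    (hD : ∀ y, ∃ ε > 0, ∀ a ∈ D, ∀ b ∈ D, |a - y| < ε → |b - y| < ε → a = b) :
    IsClosed D := by
  refine isClosed_of_closure_subset fun y hy => ?_
  obtain ⟨ε, hε, h⟩ := hD y
  rw [Metric.mem_closure_iff] at hy
  obtain ⟨a, ha, hya⟩ := hy ε hε
  by_contra hyD
  have hne : 0 < dist y a := dist_pos.2 fun h => hyD (h ▸ ha)
  obtain ⟨b, hb, hyb⟩ := hy _ hne
  rw [dist_comm, Real.dist_eq] at hya hyb
  have := h a ha b hb hya (hyb.trans (by rwa [dist_comm, Real.dist_eq]))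
  subst this
  rw [dist_comm, Real.dist_eq] at hyb
  exact lt_irrefl _ hyb

theorem isClosedInvariant_rightNeighbors (hT : intTranslations ≤ Γ)
    (hK : IsClosedInvariant Γ K) (hL : IsClosedInvariant Γ L) (hKL : Disjoint K L) :
    IsClosedInvariant Γ (rightNeighbors K L) where
  isClosed := isClosed_of_subsingleton_near
    (exists_rightNeighbors_subsingleton_near hK.isClosed hL.isClosed hKL)
  nonempty := by
    obtain ⟨x, hx⟩ := hK.nonempty
    obtain ⟨y, hy⟩ := hL.nonempty
    have hne : (L ∩ Set.Ici x).Nonempty := by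
      refine ⟨y + (⌈x - y⌉ : ℤ), hL.add_int_mem hT hy _, ?_⟩
      have := Int.le_ceil (x - y)
      simp only [Set.mem_Ici]; linarith
    have hbdd : BddBelow (L ∩ Set.Ici x) := ⟨x, fun y hy => hy.2⟩
    have hm := (hL.isClosed.inter isClosed_Ici).csInf_mem hne hbdd
    refine ⟨_, hm.1, x, hx, lt_of_le_of_ne hm.2 ?_, fun z hz hxz => csInf_le hbdd ⟨hz, hxz.le⟩⟩
    intro h
    exact hKL.le_bot ⟨hx, h ▸ hm.1⟩
  map_mem := by
    rintro γ hγ y ⟨hy, x, hx, hxy, h⟩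
    refine ⟨hL.map_mem γ hγ y hy, γ x, hK.map_mem γ hγ x hx, units_strictMono γ hxy,
      fun z hz hxz => ?_⟩
    have h1 := h ((γ⁻¹ : CircleDeg1Liftˣ) z) (hL.map_mem _ (Γ.inv_mem hγ) z hz) (by
      rwa [← (units_strictMono γ).lt_iff_lt, units_apply_inv_apply])
    rwa [← (units_strictMono γ).le_iff_le, units_apply_inv_apply] at h1

theorem map_le_self_of_subsingleton_near (hT : intTranslations ≤ Γ) {D : Set ℝ}
    (hinv : IsClosedInvariant Γ D)
    (hD : ∀ y, ∃ ε > 0, ∀ a ∈ D, ∀ b ∈ D, |a - y| < ε → |b - y| < ε → a = b)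
    {γ : CircleDeg1Liftˣ} (hγ : γ ∈ Γ) {x y : ℝ} (hx : x ∈ D) (hy : y ∈ D) (hle : γ x ≤ x) :
    γ y ≤ y := by
  by_contra! hlt
  set x' := x + (⌊y - x⌋ : ℤ)
  have hx' : x' ∈ D := hinv.add_int_mem hT hx _
  have hx'y : x' ≤ y := by have := Int.floor_le (y - x); simp only [x']; linarith
  have hle' : γ x' ≤ x' := by simp only [x', map_add_int]; linarith
  obtain ⟨m, ⟨hmD, hm1, hm2⟩, hm⟩ := exists_isLeast_of_subsingleton_near hD
    (S := {z | z ∈ D ∧ x' ≤ z ∧ z < γ z}) (fun z hz => hz.1) ⟨y, hy, hx'y, hlt⟩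
    ⟨x', fun z hz => hz.2.1⟩
  -- the larger of the starting point and of `γ⁻¹ m` lies in `D` below `m`, and so is not moved up by `γ`
  have hxm : x' < m := lt_of_le_of_ne hm1 (by rintro rfl; exact hle'.not_gt hm2)
  have hγm : (γ⁻¹ : CircleDeg1Liftˣ) m < m := by
    rwa [← (units_strictMono γ).lt_iff_lt, units_apply_inv_apply]
  have hmax : γ (max x' ((γ⁻¹ : CircleDeg1Liftˣ) m)) ≤ max x' ((γ⁻¹ : CircleDeg1Liftˣ) m) := by
    by_contra! h
    have hmem : max x' ((γ⁻¹ : CircleDeg1Liftˣ) m) ∈ D := by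
      rcases max_choice x' ((γ⁻¹ : CircleDeg1Liftˣ) m) with h | h <;> rw [h]
      exacts [hx', hinv.map_mem _ (Γ.inv_mem hγ) m hmD]
    exact (hm ⟨hmem, le_max_left _ _, h⟩).not_gt (max_lt hxm hγm)
  have h1 := (units_strictMono γ).monotone (le_max_right x' ((γ⁻¹ : CircleDeg1Liftˣ) m))
  rw [units_apply_inv_apply] at h1
  exact (h1.trans hmax).not_gt (max_lt hxm hγm)

/-- Given two commuting groups of lifts of circle homeomorphisms, the commutators of one of them
have a common fixed point. -/
theorem exists_commutator_fixed_point_of_commute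
    (hΓ : intTranslations ≤ Γ) (hΔ : intTranslations ≤ Δ)
    (hcomm : ∀ γ ∈ Γ, ∀ δ ∈ Δ, Commute γ δ) :
    (∃ x : ℝ, ∀ a ∈ Γ, ∀ b ∈ Γ, ⁅a, b⁆ x = x) ∨ ∃ x : ℝ, ∀ a ∈ Δ, ∀ b ∈ Δ, ⁅a, b⁆ x = x := by
  obtain ⟨K, hK, hmin⟩ := exists_minimal_isClosedInvariant hΓ
  by_cases hdis : ∃ δ ∈ Δ, Disjoint K (δ '' K)
  · obtain ⟨δ, hδ, hdis⟩ := hdis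
    have hL := hK.image fun γ hγ => hcomm γ hγ δ hδ
    have hinv := isClosedInvariant_rightNeighbors hΓ hK hL hdis
    obtain ⟨x, hx⟩ := hinv.nonempty
    exact Or.inl ⟨x, fun a ha b hb => commutator_apply_eq_self hΓ hinv
      (fun γ hγ x hx y hy => map_le_self_of_subsingleton_near hΓ hinv
        (exists_rightNeighbors_subsingleton_near hK.isClosed hL.isClosed hdis) hγ hx hy)
      ha hb hx⟩
  · push Not at hdis
    have hsub : ∀ δ ∈ Δ, K ⊆ δ '' K := fun δ hδ => by
      have hL := hK.image fun γ hγ => hcomm γ hγ δ hδ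
      refine (hmin (K ∩ δ '' K) ⟨hK.isClosed.inter hL.isClosed,
        Set.not_disjoint_iff_nonempty_inter.1 (hdis δ hδ),
        fun γ hγ x hx => ⟨hK.map_mem γ hγ x hx.1, hL.map_mem γ hγ x hx.2⟩⟩
        Set.inter_subset_left).trans Set.inter_subset_right
    have hinv : IsClosedInvariant Δ K := ⟨hK.isClosed, hK.nonempty, fun δ hδ x hx => by
      obtain ⟨y, hy, hyx⟩ := hsub δ⁻¹ (Δ.inv_mem hδ) hx
      rwa [← hyx, units_apply_inv_apply]⟩
    obtain ⟨x, hx⟩ := hK.nonempty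
    refine Or.inr ⟨x, fun a ha b hb => commutator_apply_eq_self hΔ hinv ?_ ha hb hx⟩
    intro δ hδ x hx y hy hle
    refine (hmin {z | z ∈ K ∧ δ z ≤ z} ⟨?_, ⟨x, hx, hle⟩, ?_⟩ (fun z hz => hz.1) hy).2
    · exact hK.isClosed.inter (isClosed_le (units_continuous δ) continuous_id)
    · intro γ hγ z hz
      refine ⟨hK.map_mem γ hγ z hz.1, ?_⟩
      rw [← units_mul_apply, ← (hcomm γ hγ δ hδ).eq, units_mul_apply]
      exact γ.val.monotone hz.2

end CircleDeg1Lift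

section Lifts

theorem homeomorph_mul_apply (f g : UnitAddCircle ≃ₜ UnitAddCircle) (x : UnitAddCircle) :
    (f * g) x = f (g x) := rfl

theorem homeomorph_one_apply (x : UnitAddCircle) :
    (1 : UnitAddCircle ≃ₜ UnitAddCircle) x = x := rfl

/-- Two continuous lifts of the same map differ by an integer constant. -/
theorem exists_int_eq_add_of_coe_eq {F G : ℝ → ℝ} (hF : Continuous F) (hG : Continuous G)
    (h : ∀ x, (F x : UnitAddCircle) = G x) : ∃ n : ℤ, ∀ x, F x = G x + n := by
  have hn : ∀ x, ∃ n : ℤ, F x - G x = n := fun x => by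
    have h0 : ((F x - G x : ℝ) : UnitAddCircle) = 0 := by rw [AddCircle.coe_sub, h, sub_self]
    obtain ⟨n, hn⟩ := (AddCircle.coe_eq_zero_iff 1).1 h0
    exact ⟨n, by rw [← hn, zsmul_one]⟩
  choose n hn using hn
  have hc : Continuous n := by
    rw [Int.isClosedEmbedding_coe_real.isEmbedding.continuous_iff]
    exact (hF.sub hG).congr hn
  refine ⟨n 0, fun x => ?_⟩
  rw [← PreconnectedSpace.constant inferInstance hc (x := x), ← hn]
  ring

namespace CircleDeg1Lift

/-- The unit `u` lifts the circle map `f`. -/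
def IsLiftOf (u : CircleDeg1Liftˣ) (f : UnitAddCircle ≃ₜ UnitAddCircle) : Prop :=
  ∀ x : ℝ, f (x : UnitAddCircle) = ((u x : ℝ) : UnitAddCircle)

variable {u v : CircleDeg1Liftˣ} {f g : UnitAddCircle ≃ₜ UnitAddCircle}

theorem IsLiftOf.mul (hu : IsLiftOf u f) (hv : IsLiftOf v g) : IsLiftOf (u * v) (f * g) :=
  fun x => by rw [homeomorph_mul_apply, hv, hu, units_mul_apply]

theorem isLiftOf_one : IsLiftOf 1 1 := fun _ => rfl

theorem IsLiftOf.inv (hu : IsLiftOf u f) : IsLiftOf u⁻¹ f⁻¹ := fun x => by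
  have h := hu ((u⁻¹ : CircleDeg1Liftˣ) x)
  rw [units_apply_inv_apply] at h
  rw [← h]
  exact f.symm_apply_apply _

theorem isLiftOf_translate_int (n : ℤ) : IsLiftOf (translate (Multiplicative.ofAdd (n : ℝ))) 1 :=
  fun x => by
    have h0 : ((n : ℝ) : UnitAddCircle) = 0 := (AddCircle.coe_eq_zero_iff 1).2 ⟨n, zsmul_one n⟩
    rw [translate_apply, homeomorph_one_apply, AddCircle.coe_add, h0, zero_add]

theorem commute_of_isLiftOf (hu : IsLiftOf u f) (hv : IsLiftOf v g) (hfg : Commute f g) :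
    Commute u v := by
  have hconj : IsLiftOf (u * v * u⁻¹) g := by
    have := (hu.mul hv).mul hu.inv
    rwa [hfg.eq, mul_inv_cancel_right] at this
  obtain ⟨n, hn⟩ := exists_int_eq_add_of_coe_eq (units_continuous (u * v * u⁻¹))
    (units_continuous v) fun x => by rw [← hconj, ← hv]
  have hT : Commute (translate (Multiplicative.ofAdd (n : ℝ)) : CircleDeg1Lift) v :=
    commute_iff_commute.2 fun x => by simp
  have heq : (↑(u * v * u⁻¹) : CircleDeg1Lift) =
      translate (Multiplicative.ofAdd (n : ℝ)) * v := by
    ext x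
    rw [hn, mul_apply, translate_apply, add_comm]
  have hτ := translationNumber_mul_of_commute hT
  rw [← heq, Units.val_mul, Units.val_mul, translationNumber_conj_eq, translationNumber_translate,
    right_eq_add, Int.cast_eq_zero] at hτ
  subst hτ
  refine mul_inv_eq_iff_eq_mul.1 (Units.ext ?_)
  ext x
  rw [hn, Int.cast_zero, add_zero]

variable {A : Type*} [Group A] (σ : A →* (UnitAddCircle ≃ₜ UnitAddCircle))

/-- The group of all orientation-preserving lifts of the elements of a group action. -/
def liftSubgroup : Subgroup CircleDeg1Liftˣ where
  carrier := {u | ∃ a, IsLiftOf u (σ a)}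
  mul_mem' := by
    rintro u v ⟨a, ha⟩ ⟨b, hb⟩
    exact ⟨a * b, by rw [map_mul]; exact ha.mul hb⟩
  one_mem' := ⟨1, by rw [map_one]; exact isLiftOf_one⟩
  inv_mem' := by
    rintro u ⟨a, ha⟩
    exact ⟨a⁻¹, by rw [map_inv]; exact ha.inv⟩

theorem intTranslations_le_liftSubgroup : intTranslations ≤ liftSubgroup σ := by
  rintro _ ⟨n, rfl⟩
  exact ⟨1, by rw [map_one]; exact isLiftOf_translate_int n.toAdd⟩

end CircleDeg1Lift

open CircleDeg1Lift

theorem IsC1Lift.injective {f : UnitAddCircle ≃ₜ UnitAddCircle} {F : ℝ → ℝ} (hF : IsC1Lift f F) :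
    Function.Injective F := by
  have key : ∀ x y, x < y → F x ≠ F y := fun x y hxy h => by
    obtain ⟨c, -, hc⟩ := exists_deriv_eq_zero hxy hF.1.continuous.continuousOn h
    exact hF.2.1 c hc
  intro x y h
  rcases lt_trichotomy x y with hxy | hxy | hxy
  exacts [absurd h (key x y hxy), hxy, absurd h.symm (key y x hxy)]

theorem IsC1Lift.exists_isLiftOf_mul_self {f : UnitAddCircle ≃ₜ UnitAddCircle} {F : ℝ → ℝ}
    (hF : IsC1Lift f F) : ∃ u, IsLiftOf u (f * f) := by
  have hmono : Monotone (F ∘ F) := by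
    rcases hF.1.continuous.strictMono_of_inj hF.injective with h | h
    exacts [(h.comp h).monotone, (h.comp h).monotone]
  let g : CircleDeg1Lift := ⟨⟨F ∘ F, hmono⟩, fun x => by
    change F (F (x + 1)) = F (F x) + 1
    rcases hF.2.2.1 with h | h
    · rw [h, h]
    · have := h (F x - 1)
      rw [sub_add_cancel] at this
      rw [h, this, sub_add_cancel]⟩
  have hg : Function.Bijective g := ⟨hF.injective.comp hF.injective,
    g.continuous_iff_surjective.1 (hF.1.continuous.comp hF.1.continuous)⟩
  obtain ⟨u, hu⟩ := isUnit_iff_bijective.2 hg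
  refine ⟨u, fun x => ?_⟩
  rw [homeomorph_mul_apply, hF.2.2.2, hF.2.2.2, hu]
  rfl

variable {A : Type*} [Group A] {σ : A →* (UnitAddCircle ≃ₜ UnitAddCircle)}

theorem Group.IsPerfect.eq_top_of_commutator_mem [Group.IsPerfect A] (H : Subgroup A)
    (h : ∀ a b : A, ⁅a, b⁆ ∈ H) : H = ⊤ := by
  rw [eq_top_iff, ← Group.IsPerfect.commutator_eq_top (G := A), commutator_eq_closure,
    Subgroup.closure_le]
  rintro _ ⟨a, b, rfl⟩
  exact h a b

theorem exists_isLiftOf_of_isPerfect [Group.IsPerfect A] (hσ : IsC1Action σ) (a : A) :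
    ∃ u, IsLiftOf u (σ a) := by
  let H : Subgroup A :=
    { carrier := {a | ∃ u, IsLiftOf u (σ a)}
      mul_mem' := by
        rintro a b ⟨u, hu⟩ ⟨v, hv⟩
        exact ⟨u * v, by rw [map_mul]; exact hu.mul hv⟩
      one_mem' := ⟨1, by rw [map_one]; exact isLiftOf_one⟩
      inv_mem' := by
        rintro a ⟨u, hu⟩
        exact ⟨u⁻¹, by rw [map_inv]; exact hu.inv⟩ }
  have hsq : ∀ a, a * a ∈ H := fun a => by
    obtain ⟨F, hF⟩ := hσ a
    obtain ⟨u, hu⟩ := hF.exists_isLiftOf_mul_self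
    exact ⟨u, by rwa [map_mul]⟩
  have hH : H = ⊤ := Group.IsPerfect.eq_top_of_commutator_mem H fun a b => by
    have : ⁅a, b⁆ = (a * b) * (a * b) * ((b⁻¹ * a⁻¹ * b) * (b⁻¹ * a⁻¹ * b)) * (b⁻¹ * b⁻¹) := by
      rw [commutatorElement_def]
      group
    rw [this]
    exact H.mul_mem (H.mul_mem (hsq _) (hsq _)) (hsq _)
  exact (hH ▸ Subgroup.mem_top a : a ∈ H)

/-- A perfect group of circle homeomorphisms fixes every point whose lift is fixed by all
commutators of lifts. -/
theorem apply_coe_eq_of_commutator_fixed [Group.IsPerfect A] (hσ : IsC1Action σ) {p : ℝ}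
    (hp : ∀ u ∈ liftSubgroup σ, ∀ v ∈ liftSubgroup σ, ⁅u, v⁆ p = p) (a : A) :
    σ a (p : UnitAddCircle) = p := by
  let H : Subgroup A :=
    { carrier := {a | σ a (p : UnitAddCircle) = p}
      mul_mem' := fun {a b} (ha : _ = _) (hb : _ = _) => by
        rw [Set.mem_ofPred_eq, map_mul, homeomorph_mul_apply, hb, ha]
      one_mem' := by rw [Set.mem_ofPred_eq, map_one, homeomorph_one_apply]
      inv_mem' := fun {a} (ha : _ = _) => by
        rw [Set.mem_ofPred_eq, map_inv]
        conv_lhs => rw [← ha]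
        exact (σ a).symm_apply_apply _ }
  have hH : H = ⊤ := Group.IsPerfect.eq_top_of_commutator_mem H fun a b => by
    obtain ⟨u, hu⟩ := exists_isLiftOf_of_isPerfect hσ a
    obtain ⟨v, hv⟩ := exists_isLiftOf_of_isPerfect hσ b
    have : IsLiftOf ⁅u, v⁆ ⁅σ a, σ b⁆ := ((hu.mul hv).mul hu.inv).mul hv.inv
    change σ ⁅a, b⁆ p = p
    rw [map_commutatorElement, this, hp u ⟨a, hu⟩ v ⟨b, hv⟩]
  exact (hH ▸ Subgroup.mem_top a : a ∈ H)

/-- **Thurston stability** on the circle: a finitely generated perfect group of `C¹`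
diffeomorphisms of the circle with a global fixed point is trivial. -/
theorem IsC1Action.eq_one_of_fixed_point [Group.IsPerfect A] [Group.FG A] (hσ : IsC1Action σ)
    {p : ℝ} (hp : ∀ a, σ a (p : UnitAddCircle) = p) (a : A) : σ a = 1 := by
  have hlift : ∀ a, ∃ F : ℝ → ℝ, ContDiff ℝ 1 F ∧ F p = p ∧
      ∀ x : ℝ, σ a (x : UnitAddCircle) = F x := fun a => by
    obtain ⟨F, hF⟩ := hσ a
    refine ⟨fun x => F x - (F p - p), hF.1.sub contDiff_const, by ring, fun x => ?_⟩
    have h := hF.2.2.2 p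
    rw [hp] at h
    rw [hF.2.2.2, AddCircle.coe_sub, AddCircle.coe_sub, ← h, sub_self, sub_zero]
  choose F hC hFp hF using hlift
  have huniq : ∀ G₁ G₂ : ℝ → ℝ, Continuous G₁ → Continuous G₂ → G₁ p = p → G₂ p = p →
      (∀ x, (G₁ x : UnitAddCircle) = G₂ x) → ∀ x, G₁ x = G₂ x := by
    intro G₁ G₂ h₁ h₂ hp₁ hp₂ h x
    obtain ⟨n, hn⟩ := exists_int_eq_add_of_coe_eq h₁ h₂ h
    have := hn p
    rw [hp₁, hp₂, left_eq_add] at this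
    rw [hn, this, add_zero]
  let _ : MulAction A ℝ :=
    { smul := F
      one_smul := huniq (F 1) id (hC 1).continuous continuous_id (hFp 1) rfl fun x => by
        rw [← hF, map_one, homeomorph_one_apply, id]
      mul_smul := fun a b => huniq (F (a * b)) (F a ∘ F b) (hC _).continuous
        ((hC a).continuous.comp (hC b).continuous) (hFp _)
        (by rw [Function.comp_apply, hFp, hFp]) fun x => by
        rw [← hF, map_mul, homeomorph_mul_apply, hF, hF, Function.comp_apply] }
  have htriv : ∀ x, F a x = x := fun x => smul_eq_self_of_isPerfect_of_fg (A := A) hC hFp a x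
  refine Homeomorph.ext fun y => ?_
  obtain ⟨x, rfl⟩ := QuotientAddGroup.mk_surjective y
  exact (hF a x).trans (by rw [htriv]; rfl)

theorem IsC1Action.trivial_or_trivial_of_commute {B : Type*} [Group B]
    {τ : B →* (UnitAddCircle ≃ₜ UnitAddCircle)} [Group.IsPerfect A] [Group.FG A]
    [Group.IsPerfect B] [Group.FG B] (hσ : IsC1Action σ) (hτ : IsC1Action τ)
    (hcomm : ∀ a b, Commute (σ a) (τ b)) : (∀ a, σ a = 1) ∨ ∀ b, τ b = 1 := by
  rcases exists_commutator_fixed_point_of_commute (intTranslations_le_liftSubgroup σ)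
    (intTranslations_le_liftSubgroup τ) (by
      rintro u ⟨a, hu⟩ v ⟨b, hv⟩
      exact commute_of_isLiftOf hu hv (hcomm a b)) with ⟨p, hp⟩ | ⟨p, hp⟩
  · exact Or.inl (hσ.eq_one_of_fixed_point (apply_coe_eq_of_commutator_fixed hσ hp))
  · exact Or.inr (hτ.eq_one_of_fixed_point (apply_coe_eq_of_commutator_fixed hτ hp))

theorem Group.isPerfect_of_subsingleton_abelianization (A : Type*) [Group A]
    (h : Subsingleton (Abelianization A)) : Group.IsPerfect A :=
  ⟨QuotientGroup.subgroup_eq_top_of_subsingleton _ h⟩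

end Lifts

/-- **Corollary.** For a `C¹` action of a finite product `G₁ × ⋯ × Gₙ` of
finitely generated groups with trivial abelianization on the circle, at most
one factor acts nontrivially. -/
theorem at_most_one_nontrivial_factor
    {n : ℕ} (hn : 1 ≤ n) (G : Fin n → Type*) [∀ i, Group (G i)]
    (hfg : ∀ i, Group.FG (G i))
    (hab : ∀ i, Subsingleton (Abelianization (G i)))
    (ρ : (∀ i, G i) →* (UnitAddCircle ≃ₜ UnitAddCircle))
    (hρ : IsC1Action ρ) :
    ∀ i j : Fin n, i ≠ j →
      (∀ g : G i, ρ (Pi.mulSingle i g) = Homeomorph.refl UnitAddCircle) ∨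
      (∀ g : G j, ρ (Pi.mulSingle j g) = Homeomorph.refl UnitAddCircle) := by
  intro i j hij
  have hperf := fun i => Group.isPerfect_of_subsingleton_abelianization (G i) (hab i)
  exact IsC1Action.trivial_or_trivial_of_commute
    (σ := ρ.comp (MonoidHom.mulSingle G i)) (τ := ρ.comp (MonoidHom.mulSingle G j))
    (fun a => hρ _) (fun b => hρ _) fun a b => (Pi.mulSingle_commute hij a b).map ρ
end

section
/- For every n ≥ 3, the automorphism group Aut(F_n) of the free group F_n on n generators contains a subgroup T of index 2 with the following properties: there exist families of elements A_{ij}, B_{ij} ∈ Aut(F_n), indexed by pairs 1 ≤ i, j ≤ n with i ≠ j, such that T is generated by the (finite) set {A_{ij}, B_{ij} : i ≠ j}; the abelianization of T is trivial (H₁(T,ℤ) = 0, i.e. T is perfect); and for all valid index pairs (i,j) and (k,l) with i ≠ j and k ≠ l, A_{ij} is conjugate to A_{kl} by an element of T and B_{ij} is conjugate to B_{kl} by an element of T. -/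
namespace FreeGroup

section Cancellation

variable {α : Type*}

theorem exists_isReduced_invRev_append {L₁ L₂ : List (α × Bool)} (h₁ : IsReduced L₁)
    (h₂ : IsReduced L₂) :
    ∃ p a b, L₁ = p ++ a ∧ L₂ = p ++ b ∧ IsReduced (invRev a ++ b) := by
  classical
  induction L₁ generalizing L₂ with
  | nil => exact ⟨[], [], L₂, rfl, rfl, by simpa using h₂⟩
  | cons c L₁ ih =>
    cases L₂ with
    | nil =>
      refine ⟨[], c :: L₁, [], rfl, rfl, ?_⟩
      rw [isReduced_iff_reduce_eq] at h₁ ⊢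
      rw [List.append_nil, reduce_invRev, h₁]
    | cons d L₂ =>
      by_cases hcd : c = d
      · subst hcd
        obtain ⟨p, a, b, rfl, rfl, hab⟩ := ih h₁.tail h₂.tail
        exact ⟨c :: p, a, b, rfl, rfl, hab⟩
      · refine ⟨[], c :: L₁, d :: L₂, rfl, rfl, ?_⟩
        have h₁' : IsReduced (invRev (c :: L₁)) := by
          rw [isReduced_iff_reduce_eq] at h₁ ⊢
          rw [reduce_invRev, h₁]
        refine List.isChain_append.2 ⟨h₁', h₂, ?_⟩
        obtain ⟨c, x⟩ := c
        obtain ⟨d, y⟩ := d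
        simp only [invRev, List.map_cons, List.reverse_cons, List.getLast?_append,
          List.getLast?_singleton, Option.some_or, Option.mem_def, Option.some.injEq,
          List.head?_cons, forall_eq']
        rintro rfl
        cases x <;> cases y <;> simp_all

variable [DecidableEq α]

theorem exists_toWord_inv_mul (x y : FreeGroup α) :
    ∃ p a b, x.toWord = p ++ a ∧ y.toWord = p ++ b ∧ (x⁻¹ * y).toWord = invRev a ++ b := by
  obtain ⟨p, a, b, hx, hy, hab⟩ :=
    exists_isReduced_invRev_append (isReduced_toWord (x := x)) (isReduced_toWord (x := y))
  refine ⟨p, a, b, hx, hy, ?_⟩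
  have : x⁻¹ * y = mk (invRev a ++ b) := by
    rw [← mk_toWord (x := x), ← mk_toWord (x := y), hx, hy]
    simp only [← mul_mk, ← inv_mk]
    group
  rw [this, toWord_mk, hab.reduce_eq]

theorem norm_inv_mul_le_of_toWord_eq_append {x y : FreeGroup α} {p a b : List (α × Bool)}
    (hx : x.toWord = p ++ a) (hy : y.toWord = p ++ b) :
    norm (x⁻¹ * y) ≤ a.length + b.length := by
  have : x⁻¹ * y = mk (invRev a ++ b) := by
    rw [← mk_toWord (x := x), ← mk_toWord (x := y), hx, hy]
    simp only [← mul_mk, ← inv_mk]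
    group
  rw [this]
  exact norm_mk_le.trans (by simp)

/-- Gromov products in a free group satisfy the ultrametric inequality. -/
theorem norm_inv_mul_add_norm_le_max (x y z : FreeGroup α) :
    norm (x⁻¹ * z) + norm y ≤ max (norm (x⁻¹ * y) + norm z) (norm (y⁻¹ * z) + norm x) := by
  obtain ⟨p, a, b, hx, hy, hxy⟩ := exists_toWord_inv_mul x y
  obtain ⟨q, c, d, hy', hz, hyz⟩ := exists_toWord_inv_mul y z
  have key : norm (x⁻¹ * z) + 2 * min p.length q.length ≤ norm x + norm z := by
    have hpq := hy.symm.trans hy'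
    rcases List.append_eq_append_iff.1 hpq with ⟨r, rfl, rfl⟩ | ⟨r, rfl, rfl⟩
    · have := norm_inv_mul_le_of_toWord_eq_append hx (hz.trans (List.append_assoc _ _ _))
      simp only [norm, hx, hz, List.length_append] at this ⊢
      omega
    · have := norm_inv_mul_le_of_toWord_eq_append (hx.trans (List.append_assoc _ _ _)) hz
      simp only [norm, hx, hz, List.length_append] at this ⊢
      omega
  have l₁ := congrArg List.length hx
  have l₂ := congrArg List.length hy
  have l₃ := congrArg List.length hxy
  have l₄ := congrArg List.length hy'
  have l₅ := congrArg List.length hz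
  have l₆ := congrArg List.length hyz
  simp only [List.length_append, invRev_length] at l₁ l₂ l₃ l₄ l₅ l₆
  simp only [norm] at key ⊢
  omega

theorem norm_lt_norm_mul_self {x : FreeGroup α} (hx : x ≠ 1) : norm x < norm (x * x) := by
  by_contra! hle
  obtain ⟨p, a, b, h₁, h₂, h₃⟩ := exists_toWord_inv_mul x⁻¹ x
  rw [inv_inv] at h₃
  have l₁ := congrArg List.length h₁
  have l₂ := congrArg List.length h₂
  have l₃ := congrArg List.length h₃
  simp only [toWord_inv, List.length_append, invRev_length] at l₁ l₂ l₃
  simp only [norm] at hle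
  have hinv : x.toWord = invRev a ++ invRev p := by
    rw [← invRev_append, ← h₁, toWord_inv, invRev_invRev]
  obtain ⟨r, hp, hr⟩ : ∃ r, p = invRev a ++ r ∧ invRev p = r ++ b := by
    rcases List.append_eq_append_iff.1 (h₂.symm.trans hinv) with ⟨r, hr, hb⟩ | h
    · obtain rfl : r = [] := by
        have := congrArg List.length hr
        simp only [invRev_length, List.length_append] at this
        exact List.length_eq_zero_iff.1 (by omega)
      exact ⟨[], by simpa using hr.symm, by simpa using hb.symm⟩
    · exact h
  have hrr : r = invRev r := by
    have := congrArg invRev hp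
    rw [invRev_append, invRev_invRev, hr] at this
    exact (List.append_inj this (by simp)).1
  have hr1 : mk r = 1 := by
    rw [← self_eq_inv, inv_mk, ← hrr]
  have hpb : (mk p)⁻¹ = mk b := by
    rw [inv_mk, hr, ← mul_mk, hr1, one_mul]
  apply hx
  rw [← mk_toWord (x := x), h₂, ← mul_mk, ← hpb, mul_inv_cancel]

end Cancellation

section NielsenReduced

variable {α β : Type*} [DecidableEq β]

/-- The homomorphism `f` maps the basis of a free group to a Nielsen reduced family. -/
structure IsNielsenReduced (f : FreeGroup α →* FreeGroup β) : Prop where intro ::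
  ne_one (a : α × Bool) : f (mk [a]) ≠ 1
  norm_le (a b : α × Bool) (h : IsReduced [a, b]) :
    norm (f (mk [a])) ≤ norm (f (mk [a, b])) ∧ norm (f (mk [b])) ≤ norm (f (mk [a, b]))
  norm_add_lt (a b c : α × Bool) (h : IsReduced [a, b, c]) :
    norm (f (mk [a])) + norm (f (mk [c])) < norm (f (mk [a, b])) + norm (f (mk [b, c]))

variable {f : FreeGroup α →* FreeGroup β}

theorem IsNielsenReduced.norm_map_cons_cons (hf : IsNielsenReduced f) {a b : α × Bool}
    {L : List (α × Bool)} (h : IsReduced (a :: b :: L)) :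
    norm (f (mk (a :: b :: L))) + norm (f (mk [b])) =
      norm (f (mk [a, b])) + norm (f (mk (b :: L))) := by
  induction L generalizing a b with
  | nil => rfl
  | cons c L ih =>
    have ihb := ih (a := b) (b := c) h.tail
    have hlt := hf.norm_add_lt a b c (h.take 3)
    set x := f (mk [a]) with hx
    set y := f (mk [b]) with hy
    set z := f (mk (b :: c :: L)) with hz
    have hxy : f (mk [a, b]) = x * y := by rw [hx, hy, ← _root_.map_mul, mul_mk]; rfl
    have hxz : f (mk (a :: b :: c :: L)) = x * z := by rw [hx, hz, ← _root_.map_mul, mul_mk]; rfl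
    have hyz : f (mk (c :: L)) = y⁻¹ * z := by
      rw [eq_inv_mul_iff_mul_eq, hy, hz, ← _root_.map_mul, mul_mk]; rfl
    rw [hxy] at hlt ⊢
    rw [hxz]
    rw [hyz] at ihb
    have u₁ := norm_inv_mul_add_norm_le_max x⁻¹ y z
    have u₂ := norm_inv_mul_add_norm_le_max x⁻¹ z y
    rw [← norm_inv_eq (x := z⁻¹ * y), mul_inv_rev, inv_inv z] at u₂
    rw [inv_inv, norm_inv_eq] at u₁ u₂
    omega

theorem IsNielsenReduced.two_le_norm_map (hf : IsNielsenReduced f) {a b : α × Bool}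
    {L : List (α × Bool)} (h : IsReduced (a :: b :: L)) : 2 ≤ norm (f (mk (a :: b :: L))) := by
  induction L generalizing a b with
  | nil =>
    obtain ⟨ha, hb⟩ := hf.norm_le a b h
    have ha1 := norm_eq_zero.not.2 (hf.ne_one a)
    have hb1 := norm_eq_zero.not.2 (hf.ne_one b)
    obtain ⟨p, s, t, h₁, h₂, h₃⟩ := exists_toWord_inv_mul (f (mk [a]))⁻¹ (f (mk [b]))
    have hab : f (mk [a, b]) = f (mk [a]) * f (mk [b]) := by rw [← _root_.map_mul, mul_mk]; rfl
    rw [inv_inv, ← hab] at h₃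
    have l₁ := congrArg List.length h₁
    have l₂ := congrArg List.length h₂
    have l₃ := congrArg List.length h₃
    simp only [toWord_inv, List.length_append, invRev_length] at l₁ l₂ l₃
    simp only [norm] at *
    omega
  | cons c L ih =>
    have := ih (a := b) (b := c) h.tail
    have := hf.norm_map_cons_cons h
    have := (hf.norm_le a b (h.take 2)).2
    omega

theorem IsNielsenReduced.exists_map_eq (hf : IsNielsenReduced f) {x : FreeGroup α}
    (hx : norm (f x) = 1) : ∃ a, f (mk [a]) = f x := by
  classical
  have hred := isReduced_toWord (x := x)
  have hmk := mk_toWord (x := x)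
  rcases hL : x.toWord with _ | ⟨a, _ | ⟨b, L⟩⟩
  · rw [toWord_eq_nil_iff] at hL
    simp [hL] at hx
  · exact ⟨a, by rw [← hL, hmk]⟩
  · rw [hL] at hred hmk
    have := hf.two_le_norm_map hred
    rw [hmk] at this
    omega

end NielsenReduced

section Midpoint

variable {α : Type*} [Fintype α]

/-- A numerical code for words, injective on words of a given length. -/
noncomputable def wordCode (L : List (α × Bool)) : ℕ :=
  Nat.ofDigits (Fintype.card (α × Bool) + 2) (L.map fun a => (Fintype.equivFin (α × Bool) a : ℕ))

theorem wordCode_append (L₁ L₂ : List (α × Bool)) :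
    wordCode (L₁ ++ L₂) =
      wordCode L₁ + (Fintype.card (α × Bool) + 2) ^ L₁.length * wordCode L₂ := by
  simp [wordCode, Nat.ofDigits_append]

theorem eq_of_wordCode_eq {L₁ L₂ : List (α × Bool)} (hlen : L₁.length = L₂.length)
    (h : wordCode L₁ = wordCode L₂) : L₁ = L₂ := by
  have hdigit (L : List (α × Bool)) :
      ∀ d ∈ L.map fun a => (Fintype.equivFin (α × Bool) a : ℕ), d < Fintype.card (α × Bool) + 2 := by
    intro d hd
    obtain ⟨a, -, rfl⟩ := List.mem_map.1 hd
    exact (Fin.is_lt _).trans (by omega)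
  refine List.map_injective_iff.2 (Fin.val_injective.comp (Equiv.injective _))
    (Nat.ofDigits_inj_of_len_eq (by omega) (by simpa using hlen) (hdigit _) (hdigit _) h)

/-- The sum of the codes of the initial halves of `L` and of its inverse. -/
noncomputable def halfCode (L : List (α × Bool)) : ℕ :=
  wordCode (L.take ((L.length + 1) / 2)) + wordCode ((invRev L).take ((L.length + 1) / 2))

theorem halfCode_invRev (L : List (α × Bool)) : halfCode (invRev L) = halfCode L := by
  simp [halfCode, add_comm]

theorem halfCode_append_lt {p q b : List (α × Bool)} (hlen : p.length = q.length)
    (hb : q.length ≤ b.length) (hpq : wordCode p < wordCode q) :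
    halfCode (p ++ b) < halfCode (q ++ b) := by
  have hk : (q.length + b.length + 1) / 2 - b.length = 0 := by omega
  have hp : p.take ((q.length + b.length + 1) / 2) = p := List.take_of_length_le (by omega)
  have hq : q.take ((q.length + b.length + 1) / 2) = q := List.take_of_length_le (by omega)
  simp only [halfCode, List.length_append, hlen, invRev_append, List.take_append, invRev_length,
    hk, List.take_zero, List.append_nil, hp, hq, wordCode_append]
  omega

variable [DecidableEq α]

/-- The complexity used in Nielsen reduction: the length, refined by the codes of the initial
halves of an element and its inverse. -/
noncomputable def complexity (x : FreeGroup α) : ℕ ×ₗ ℕ :=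
  toLex (norm x, halfCode x.toWord)

theorem complexity_inv (x : FreeGroup α) : complexity x⁻¹ = complexity x := by
  simp [complexity, toWord_inv, halfCode_invRev]

theorem norm_le_of_complexity_le {x y : FreeGroup α} (h : complexity x ≤ complexity y) :
    norm x ≤ norm y := by
  rcases Prod.Lex.toLex_le_toLex.1 h with h | h
  exacts [h.le, h.1.le]

/-- If `v` cancels half of itself against both `z` and `y⁻¹`, then one of these
two products has smaller complexity. -/
theorem complexity_mul_lt_or {v y z : FreeGroup α} (hv : v ≠ 1) (hz : norm (v * z) = norm z)
    (hvz : norm v ≤ norm z) (hy : norm (v⁻¹ * y) = norm y) (hvy : norm v ≤ norm y) :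
    complexity (v * z) < complexity z ∨ complexity (v⁻¹ * y) < complexity y := by
  obtain ⟨q, a, b, h₁, h₂, h₃⟩ := exists_toWord_inv_mul v⁻¹ z
  obtain ⟨p, c, d, h₄, h₅, h₆⟩ := exists_toWord_inv_mul v y
  rw [inv_inv] at h₃
  have l₁ := congrArg List.length h₁
  have l₂ := congrArg List.length h₂
  have l₃ := congrArg List.length h₃
  have l₄ := congrArg List.length h₄
  have l₅ := congrArg List.length h₅
  have l₆ := congrArg List.length h₆
  simp only [toWord_inv, List.length_append, invRev_length] at l₁ l₂ l₃ l₄ l₅ l₆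
  simp only [norm] at hz hvz hy hvy
  have hva : v.toWord = invRev a ++ invRev q := by
    rw [← invRev_append, ← h₁, toWord_inv, invRev_invRev]
  obtain ⟨hpa, hcq⟩ := List.append_inj (h₄.symm.trans hva) (by simp; omega)
  have hcq' : invRev c = q := by rw [hcq, invRev_invRev]
  rw [← hpa] at h₃
  rw [hcq'] at h₆
  have hne : wordCode p ≠ wordCode q := by
    intro h
    have hpq := eq_of_wordCode_eq (by omega) h
    apply hv
    rw [← mk_toWord (x := v), h₄, hcq, hpq, ← mul_mk, ← inv_mk, mul_inv_cancel]
  rcases hne.lt_or_gt with h | h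
  · left
    refine Prod.Lex.toLex_lt_toLex.2 (Or.inr ⟨hz, ?_⟩)
    simp only [h₂, h₃]
    exact halfCode_append_lt (by omega) (by omega) h
  · right
    refine Prod.Lex.toLex_lt_toLex.2 (Or.inr ⟨hy, ?_⟩)
    simp only [h₅, h₆]
    exact halfCode_append_lt (by omega) (by omega) h

theorem isNielsenReduced_of_complexity_le {β : Type*} {f : FreeGroup β →* FreeGroup α}
    (hf : Function.Injective f)
    (hmin : ∀ a b : β × Bool, a.1 ≠ b.1 → complexity (f (mk [b])) ≤ complexity (f (mk [a, b]))) :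
    IsNielsenReduced f := by
  have ne_one (a : β × Bool) : f (mk [a]) ≠ 1 := by
    rw [Ne, map_eq_one_iff f hf]
    classical
    rw [← toWord_eq_nil_iff, toWord_mk]
    simp
  have hpair (a b : β × Bool) : f (mk [a, b]) = f (mk [a]) * f (mk [b]) := by
    rw [← _root_.map_mul, mul_mk]; rfl
  have hmin' (a b : β × Bool) (hab : a.1 ≠ b.1) :
      complexity (f (mk [a])) ≤ complexity (f (mk [a, b])) := by
    have := hmin (b.1, !b.2) (a.1, !a.2) hab.symm
    rw [← complexity_inv, ← complexity_inv (f (mk [_, _])), ← _root_.map_inv,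
      ← _root_.map_inv, inv_mk, inv_mk] at this
    simpa [invRev] using this
  have heq {a b : β × Bool} (h : IsReduced [a, b]) (hab : a.1 = b.1) : a = b := by
    have := (List.isChain_pair.1 h) hab
    exact Prod.ext hab this
  have norm_le (a b : β × Bool) (h : IsReduced [a, b]) :
      norm (f (mk [a])) ≤ norm (f (mk [a, b])) ∧ norm (f (mk [b])) ≤ norm (f (mk [a, b])) := by
    by_cases hab : a.1 = b.1
    · obtain rfl := heq h hab
      rw [hpair]
      exact ⟨(norm_lt_norm_mul_self (ne_one a)).le, (norm_lt_norm_mul_self (ne_one a)).le⟩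
    · exact ⟨norm_le_of_complexity_le (hmin' a b hab), norm_le_of_complexity_le (hmin a b hab)⟩
  refine ⟨ne_one, norm_le, fun a b c h => ?_⟩
  have hab : IsReduced [a, b] := h.take 2
  have hbc : IsReduced [b, c] := h.tail
  obtain ⟨ha, hb⟩ := norm_le a b hab
  obtain ⟨hb', hc⟩ := norm_le b c hbc
  by_contra! hle
  have hna : norm (f (mk [a, b])) = norm (f (mk [a])) := by omega
  have hnc : norm (f (mk [b, c])) = norm (f (mk [c])) := by omega
  have hab1 : a.1 ≠ b.1 := by
    intro h1
    obtain rfl := heq hab h1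
    have := norm_lt_norm_mul_self (ne_one a)
    rw [← hpair] at this
    omega
  have hbc1 : b.1 ≠ c.1 := by
    intro h1
    obtain rfl := heq hbc h1
    have := norm_lt_norm_mul_self (ne_one b)
    rw [← hpair] at this
    omega
  have hinv : (f (mk [b]))⁻¹ * (f (mk [a]))⁻¹ = (f (mk [a, b]))⁻¹ := by rw [hpair, mul_inv_rev]
  rcases complexity_mul_lt_or (v := f (mk [b])) (y := (f (mk [a]))⁻¹) (z := f (mk [c])) (ne_one b)
    (by rw [← hpair, hnc]) (by omega) (by rw [hinv, norm_inv_eq, norm_inv_eq, hna])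
    (by rw [norm_inv_eq]; omega) with h | h
  · rw [← hpair] at h
    exact (hmin b c hbc1).not_gt h
  · rw [hinv, complexity_inv, complexity_inv] at h
    exact (hmin' a b hab1).not_gt h

end Midpoint

section Automorphisms

variable {α : Type*}

theorem mulAut_ext {φ ψ : MulAut (FreeGroup α)} (h : ∀ k, φ (of k) = ψ (of k)) : φ = ψ :=
  MulEquiv.toMonoidHom_injective (ext_hom _ _ h)

/-- The automorphism permuting the basis according to `π`. -/
def permAut (π : Equiv.Perm α) : MulAut (FreeGroup α) := freeGroupCongr π

@[simp]
theorem permAut_of (π : Equiv.Perm α) (k : α) : permAut π (of k) = of (π k) := by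
  simp [permAut]

variable [DecidableEq α]

/-- The automorphism sending the basis element `i` to `j * i`. -/
def leftTransvection (i j : α) (h : i ≠ j) : MulAut (FreeGroup α) :=
  MonoidHom.toMulEquiv (lift fun k => if k = i then of j * of i else of k)
    (lift fun k => if k = i then (of j)⁻¹ * of i else of k)
    (by ext k; by_cases hk : k = i <;> simp [hk, h.symm])
    (by ext k; by_cases hk : k = i <;> simp [hk, h.symm])

/-- The automorphism sending the basis element `i` to `i * j`. -/
def rightTransvection (i j : α) (h : i ≠ j) : MulAut (FreeGroup α) :=
  MonoidHom.toMulEquiv (lift fun k => if k = i then of i * of j else of k)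
    (lift fun k => if k = i then of i * (of j)⁻¹ else of k)
    (by ext k; by_cases hk : k = i <;> simp [hk, h.symm])
    (by ext k; by_cases hk : k = i <;> simp [hk, h.symm])

/-- The automorphism inverting the basis element `i`. -/
def inversion (i : α) : MulAut (FreeGroup α) :=
  MonoidHom.toMulEquiv (lift fun k => if k = i then (of i)⁻¹ else of k)
    (lift fun k => if k = i then (of i)⁻¹ else of k)
    (by ext k; by_cases hk : k = i <;> simp [hk])
    (by ext k; by_cases hk : k = i <;> simp [hk])

@[simp]
theorem leftTransvection_of (i j : α) (h : i ≠ j) (k : α) :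
    leftTransvection i j h (of k) = if k = i then of j * of i else of k :=
  lift_apply_of

@[simp]
theorem leftTransvection_symm_of (i j : α) (h : i ≠ j) (k : α) :
    MulEquiv.symm (leftTransvection i j h) (of k) = if k = i then (of j)⁻¹ * of i else of k :=
  lift_apply_of

@[simp]
theorem rightTransvection_of (i j : α) (h : i ≠ j) (k : α) :
    rightTransvection i j h (of k) = if k = i then of i * of j else of k :=
  lift_apply_of

@[simp]
theorem rightTransvection_symm_of (i j : α) (h : i ≠ j) (k : α) :
    MulEquiv.symm (rightTransvection i j h) (of k) = if k = i then of i * (of j)⁻¹ else of k :=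
  lift_apply_of

@[simp]
theorem inversion_of (i k : α) : inversion i (of k) = if k = i then (of i)⁻¹ else of k :=
  lift_apply_of

theorem inversion_mul_self (i : α) : inversion i * inversion i = 1 := by
  refine mulAut_ext fun k => ?_
  by_cases hk : k = i <;> simp [hk]

variable (α) in
/-- The subgroup of the automorphism group of a free group generated by the transvections. -/
def transvectionGroup : Subgroup (MulAut (FreeGroup α)) :=
  Subgroup.closure
    {x | ∃ (i j : α) (h : i ≠ j), x = leftTransvection i j h ∨ x = rightTransvection i j h}

theorem leftTransvection_mem (i j : α) (h : i ≠ j) :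
    leftTransvection i j h ∈ transvectionGroup α :=
  Subgroup.subset_closure ⟨i, j, h, Or.inl rfl⟩

theorem rightTransvection_mem (i j : α) (h : i ≠ j) :
    rightTransvection i j h ∈ transvectionGroup α :=
  Subgroup.subset_closure ⟨i, j, h, Or.inr rfl⟩

open scoped commutatorElement

theorem commutator_leftTransvection_rightTransvection {i j k : α} (hij : i ≠ j) (hik : i ≠ k)
    (hkj : k ≠ j) :
    ⁅leftTransvection i k hik, rightTransvection k j hkj⁆ = (leftTransvection i j hij)⁻¹ := by
  refine mulAut_ext fun q => ?_
  rw [commutatorElement_def]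
  by_cases hi : q = i
  · simp [hi, hik, hij.symm, hik.symm]
  · by_cases hk : q = k <;> simp [hi, hk, hij.symm, hik.symm, hkj.symm]

theorem commutator_rightTransvection_leftTransvection {i j k : α} (hij : i ≠ j) (hik : i ≠ k)
    (hkj : k ≠ j) :
    ⁅rightTransvection i k hik, leftTransvection k j hkj⁆ = (rightTransvection i j hij)⁻¹ := by
  refine mulAut_ext fun q => ?_
  rw [commutatorElement_def]
  by_cases hi : q = i
  · simp [hi, hik, hij.symm, hik.symm]
  · by_cases hk : q = k <;> simp [hi, hk, hij.symm, hik.symm, hkj.symm]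

/-! ### Generation by transvections and one inversion -/

theorem exists_transvection_eq (a b : α × Bool) (hab : a.1 ≠ b.1) :
    ∃ s ∈ transvectionGroup α, (∀ k ≠ b.1, s (of k) = of k) ∧
      (s (of b.1) = mk [a, b] ∨ s (of b.1) = (mk [a, b])⁻¹) := by
  obtain ⟨j, x⟩ := a
  obtain ⟨i, y⟩ := b
  have h : i ≠ j := hab.symm
  have hx : ∀ z : Bool, mk [(j, x), (i, z)] = mk [(j, x)] * mk [(i, z)] := fun z => by
    rw [mul_mk]; rfl
  have hinv : ∀ k : α, mk [(k, false)] = (of k)⁻¹ := fun k => rfl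
  have htrue : ∀ k : α, mk [(k, true)] = of k := fun k => rfl
  cases y <;> cases x
  · refine ⟨_, rightTransvection_mem i j h, fun k hk => by simp_all, Or.inr ?_⟩
    simp [hx, hinv]
  · refine ⟨_, inv_mem (rightTransvection_mem i j h), fun k hk => by simp_all, Or.inr ?_⟩
    simp [hx, hinv, htrue]
  · refine ⟨_, inv_mem (leftTransvection_mem i j h), fun k hk => by simp_all, Or.inl ?_⟩
    simp [hx, hinv, htrue]
  · refine ⟨_, leftTransvection_mem i j h, fun k hk => by simp_all, Or.inl ?_⟩
    simp [hx, htrue]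

theorem inversion_conj_mem (i : α) {t : MulAut (FreeGroup α)} (ht : t ∈ transvectionGroup α) :
    inversion i * t * inversion i ∈ transvectionGroup α := by
  have hσ := inversion_mul_self i
  have hinv : (inversion i)⁻¹ = inversion i := inv_eq_of_mul_eq_one_left hσ
  induction ht using Subgroup.closure_induction with
  | mem x hx =>
    obtain ⟨k, l, h, rfl | rfl⟩ := hx
    · by_cases hk : k = i
      · subst hk
        convert inv_mem (rightTransvection_mem k l h) using 1
        refine mulAut_ext fun q => ?_
        by_cases hq : q = k <;> simp [hq, h.symm]
      by_cases hl : l = i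
      · subst hl
        convert inv_mem (leftTransvection_mem k l h) using 1
        refine mulAut_ext fun q => ?_
        by_cases hq : q = k
        · simp [hq, h]
        · by_cases hq' : q = l <;> simp [hq, hq', h.symm]
      · convert leftTransvection_mem k l h using 1
        refine mulAut_ext fun q => ?_
        by_cases hq : q = k
        · simp [hq, hk, hl]
        · by_cases hq' : q = i <;> simp [hq, hq', Ne.symm hk]
    · by_cases hk : k = i
      · subst hk
        convert inv_mem (leftTransvection_mem k l h) using 1
        refine mulAut_ext fun q => ?_
        by_cases hq : q = k <;> simp [hq, h.symm]
      by_cases hl : l = i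
      · subst hl
        convert inv_mem (rightTransvection_mem k l h) using 1
        refine mulAut_ext fun q => ?_
        by_cases hq : q = k
        · simp [hq, h]
        · by_cases hq' : q = l <;> simp [hq, hq', h.symm]
      · convert rightTransvection_mem k l h using 1
        refine mulAut_ext fun q => ?_
        by_cases hq : q = k
        · simp [hq, hk, hl]
        · by_cases hq' : q = i <;> simp [hq, hq', Ne.symm hk]
  | one => simp [hσ]
  | mul x y _ _ hx hy =>
    convert mul_mem hx hy using 1
    rw [show inversion i * x * inversion i * (inversion i * y * inversion i) =
      inversion i * x * (inversion i * inversion i) * y * inversion i by group, hσ]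
    group
  | inv x _ hx =>
    convert inv_mem hx using 1
    simp [hinv, mul_assoc]

/-- The subgroup generated by the transvections and the inversion of `i`. -/
def signedTransvectionGroup (i : α) : Subgroup (MulAut (FreeGroup α)) where
  carrier := {φ | φ ∈ transvectionGroup α ∨ φ * inversion i ∈ transvectionGroup α}
  one_mem' := Or.inl (one_mem _)
  mul_mem' := by
    rintro x y (hx | hx) (hy | hy)
    · exact Or.inl (mul_mem hx hy)
    · exact Or.inr (by rw [mul_assoc]; exact mul_mem hx hy)
    · right
      convert mul_mem hx (inversion_conj_mem i hy) using 1
      rw [show x * inversion i * (inversion i * y * inversion i) =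
        x * (inversion i * inversion i) * y * inversion i by group, inversion_mul_self]
      group
    · left
      convert mul_mem hx (inversion_conj_mem i hy) using 1
      rw [show x * inversion i * (inversion i * (y * inversion i) * inversion i) =
        x * (inversion i * inversion i) * y * (inversion i * inversion i) by group,
        inversion_mul_self]
      group
  inv_mem' := by
    rintro x (hx | hx)
    · exact Or.inl (inv_mem hx)
    · right
      convert inversion_conj_mem i (inv_mem hx) using 1
      rw [mul_inv_rev, ← mul_assoc, mul_inv_cancel, one_mul]

theorem exists_mem_transvectionGroup_rotation (i j : α) (h : i ≠ j) :
    ∃ w ∈ transvectionGroup α, w (of i) = of j ∧ w (of j) = (of i)⁻¹ ∧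
      ∀ k, k ≠ i → k ≠ j → w (of k) = of k := by
  refine ⟨rightTransvection i j h * (rightTransvection j i h.symm)⁻¹ * leftTransvection i j h,
    mul_mem (mul_mem (rightTransvection_mem i j h) (inv_mem (rightTransvection_mem j i h.symm)))
      (leftTransvection_mem i j h), ?_, ?_, fun k hi hj => ?_⟩
  · simp [h, h.symm]
  · simp [h.symm]
  · simp [hi, hj]

theorem inversion_mem_signedTransvectionGroup (i j : α) :
    inversion j ∈ signedTransvectionGroup i := by
  right
  by_cases h : i = j
  · rw [h, inversion_mul_self]
    exact one_mem _
  · obtain ⟨w, hw, hi, hj, hk⟩ := exists_mem_transvectionGroup_rotation i j h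
    convert mul_mem hw hw using 1
    refine mulAut_ext fun q => ?_
    by_cases hqi : q = i
    · simp [hqi, hi, hj, h]
    by_cases hqj : q = j
    · simp [hqj, hi, hj, Ne.symm h]
    · simp [hk q hqi hqj, hqi, hqj]

theorem mem_signedTransvectionGroup_of_forall_eq_or (i : α) (s : Finset α)
    (φ : MulAut (FreeGroup α)) (hs : ∀ k ∉ s, φ (of k) = of k)
    (hφ : ∀ k, φ (of k) = of k ∨ φ (of k) = (of k)⁻¹) : φ ∈ signedTransvectionGroup i := by
  induction s using Finset.induction_on generalizing φ with
  | empty =>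
    rw [show φ = 1 from mulAut_ext fun k => hs k (Finset.notMem_empty k)]
    exact one_mem _
  | insert a s _ ih =>
    rcases hφ a with ha | ha
    · refine ih φ (fun k hk => ?_) hφ
      by_cases hka : k = a
      · rw [hka, ha]
      · exact hs k (by simp [hka, hk])
    · rw [← mul_one φ, ← inversion_mul_self a, ← mul_assoc]
      refine mul_mem (ih _ (fun k hk => ?_) fun k => ?_)
        (inversion_mem_signedTransvectionGroup i a)
      · by_cases hka : k = a
        · simp [hka, ha]
        · simp [hka, hs k (by simp [hka, hk])]
      · by_cases hka : k = a
        · simp [hka, ha]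
        · simpa [hka] using hφ k

/-! ### The determinant -/

/-- The exponent sum of the basis element `j` in an element of the free group. -/
def exponentSum (j : α) : FreeGroup α →* Multiplicative ℤ :=
  lift fun k => Multiplicative.ofAdd (if k = j then 1 else 0)

@[simp]
theorem exponentSum_of (j k : α) :
    exponentSum j (of k) = Multiplicative.ofAdd (if k = j then 1 else 0) :=
  lift_apply_of

/-- The matrix of the action of an automorphism on the abelianization. -/
def exponentMatrix (φ : MulAut (FreeGroup α)) : Matrix α α ℤ :=
  Matrix.of fun i j => (exponentSum j (φ (of i))).toAdd

variable [Fintype α]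

theorem toAdd_exponentSum_apply (φ : MulAut (FreeGroup α)) (x : FreeGroup α) (j : α) :
    (exponentSum j (φ x)).toAdd =
      ∑ k, (exponentSum k x).toAdd * (exponentSum j (φ (of k))).toAdd := by
  induction x using FreeGroup.induction_on with
  | C1 => simp
  | of a => simp
  | inv_of a ih => simp
  | mul x y hx hy => simp [hx, hy, add_mul, Finset.sum_add_distrib]

theorem exponentMatrix_mul (φ ψ : MulAut (FreeGroup α)) :
    exponentMatrix (φ * ψ) = exponentMatrix ψ * exponentMatrix φ := by
  ext i j
  simp [exponentMatrix, Matrix.mul_apply, toAdd_exponentSum_apply φ (ψ (of i)) j]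

variable (α) in
/-- The determinant of the action of an automorphism on the abelianization. -/
def detHom : MulAut (FreeGroup α) →* ℤ where
  toFun φ := (exponentMatrix φ).det
  map_one' := by
    have : exponentMatrix (1 : MulAut (FreeGroup α)) = 1 := by
      ext i j
      simp [exponentMatrix, Matrix.one_apply]
    rw [this, Matrix.det_one]
  map_mul' φ ψ := by rw [exponentMatrix_mul, Matrix.det_mul, mul_comm]

theorem detHom_leftTransvection (i j : α) (h : i ≠ j) : detHom α (leftTransvection i j h) = 1 := by
  have : exponentMatrix (leftTransvection i j h) = Matrix.transvection i j 1 := by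
    ext k l
    by_cases hk : k = i
    · subst hk
      by_cases hl : k = l <;> by_cases hl' : j = l <;>
        simp_all [exponentMatrix, Matrix.transvection]
    · simp [exponentMatrix, Matrix.transvection, Matrix.one_apply, hk, Ne.symm hk]
  exact (congrArg Matrix.det this).trans (Matrix.det_transvection_of_ne i j h 1)

theorem detHom_rightTransvection (i j : α) (h : i ≠ j) :
    detHom α (rightTransvection i j h) = 1 := by
  have : exponentMatrix (rightTransvection i j h) = exponentMatrix (leftTransvection i j h) := by
    ext k l
    by_cases hk : k = i <;> simp [exponentMatrix, hk, add_comm]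
  exact (congrArg Matrix.det this).trans (detHom_leftTransvection i j h)

theorem detHom_inversion (i : α) : detHom α (inversion i) = -1 := by
  have : exponentMatrix (inversion i) = Matrix.diagonal fun k => if k = i then -1 else 1 := by
    ext k l
    by_cases hk : k = i <;> by_cases hl : k = l <;>
      simp_all [exponentMatrix]
  refine (congrArg Matrix.det this).trans ?_
  simp [Matrix.det_diagonal, Finset.prod_ite_eq']

theorem detHom_eq_one_of_mem {φ : MulAut (FreeGroup α)} (hφ : φ ∈ transvectionGroup α) :
    detHom α φ = 1 := by
  induction hφ using Subgroup.closure_induction with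
  | mem x hx =>
    obtain ⟨i, j, h, rfl | rfl⟩ := hx
    exacts [detHom_leftTransvection i j h, detHom_rightTransvection i j h]
  | one => exact _root_.map_one _
  | mul x y _ _ hx hy => rw [_root_.map_mul, hx, hy, one_mul]
  | inv x _ hx =>
    rw [← one_mul (detHom α x⁻¹), ← hx, ← _root_.map_mul, mul_inv_cancel, hx, _root_.map_one]

/-! ### Nielsen reduction of automorphisms -/

theorem exists_isNielsenReduced_mul (φ : MulAut (FreeGroup α)) :
    ∃ t ∈ transvectionGroup α, IsNielsenReduced (MulEquiv.toMonoidHom (φ * t)) := by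
  let μ (ψ : MulAut (FreeGroup α)) : ℕ ×ₗ ℕ := ∑ i, complexity (ψ (of i))
  obtain ⟨_, ⟨t, ht, rfl⟩, hmin⟩ := (wellFounded_lt (α := ℕ ×ₗ ℕ)).has_min
    ((fun t => μ (φ * t)) '' (transvectionGroup α : Set (MulAut (FreeGroup α))))
    ⟨_, 1, one_mem _, rfl⟩
  refine ⟨t, ht, isNielsenReduced_of_complexity_le (MulEquiv.injective (φ * t)) fun a b hab => ?_⟩
  by_contra! hlt
  obtain ⟨s, hs, hfix, hsb⟩ := exists_transvection_eq a b hab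
  refine hmin _ ⟨t * s, mul_mem ht hs, rfl⟩ ?_
  have hb : complexity ((φ * t) (mk [b])) = complexity ((φ * t) (of b.1)) := by
    obtain ⟨i, _ | _⟩ := b
    · rw [← complexity_inv, ← _root_.map_inv, inv_mk]; rfl
    · rfl
  have hsb' : complexity ((φ * (t * s)) (of b.1)) = complexity ((φ * t) (mk [a, b])) := by
    rw [← mul_assoc, MulAut.mul_apply]
    rcases hsb with h | h
    · rw [h]
    · rw [h, _root_.map_inv, complexity_inv]
  refine Finset.sum_lt_sum (fun k _ => ?_) ⟨b.1, Finset.mem_univ _, ?_⟩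
  · by_cases hk : k = b.1
    · subst hk
      rw [hsb', ← hb]
      exact hlt.le
    · rw [← mul_assoc, MulAut.mul_apply _ (φ * t), hfix k hk]
  · rw [hsb', ← hb]
    exact hlt

theorem permAut_mem_signedTransvectionGroup (i : α) (π : Equiv.Perm α) :
    permAut π ∈ signedTransvectionGroup i := by
  induction π using Equiv.Perm.swap_induction_on with
  | one =>
    rw [show permAut (1 : Equiv.Perm α) = 1 from mulAut_ext fun k => by simp]
    exact one_mem _
  | swap_mul f x y hxy hf =>
    obtain ⟨w, hw, hx, hy, hk⟩ := exists_mem_transvectionGroup_rotation x y hxy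
    have hw' : w ∈ signedTransvectionGroup i := Or.inl hw
    convert mul_mem (mul_mem hw' (inversion_mem_signedTransvectionGroup i y)) hf using 1
    refine mulAut_ext fun q => ?_
    simp only [permAut_of, MulAut.mul_apply, Equiv.Perm.coe_mul, Function.comp_apply, inversion_of]
    by_cases hqx : f q = x
    · simp [hqx, hxy, hx]
    by_cases hqy : f q = y
    · simp [hqy, hy]
    · simp [hqy, hk _ hqx hqy, Equiv.swap_apply_of_ne_of_ne hqx hqy]

/-- **Nielsen's theorem**: the automorphism group of a free group of finite rank is generated by
the transvections and an inversion. -/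
theorem signedTransvectionGroup_eq_top (i : α) : signedTransvectionGroup i = ⊤ := by
  refine (Subgroup.eq_top_iff' _).2 fun φ => ?_
  obtain ⟨t, ht, hred⟩ := exists_isNielsenReduced_mul φ
  have hex (k : α) : ∃ a : α × Bool, (φ * t) (mk [a]) = of k := by
    obtain ⟨x, hx⟩ := MulEquiv.surjective (φ * t) (of k)
    obtain ⟨a, ha⟩ := hred.exists_map_eq (x := x) ((congrArg norm hx).trans (norm_of k))
    exact ⟨a, ha.trans hx⟩
  choose a ha using hex
  have hof (k : α) : (φ * t) (of (a k).1) = of k ∨ (φ * t) (of (a k).1) = (of k)⁻¹ := by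
    rw [← ha k]
    rcases a k with ⟨j, _ | _⟩
    · exact Or.inr (by rw [← _root_.map_inv, inv_mk]; rfl)
    · exact Or.inl rfl
  have hinj : Function.Injective fun k => (a k).1 := by
    intro k l hkl
    have hk := hof k
    have hl := hof l
    simp only at hkl
    rw [hkl] at hk
    have h : of k = of l ∨ of k = (of l)⁻¹ := by
      rcases hk with hk | hk <;> rcases hl with hl | hl
      · exact Or.inl (hk.symm.trans hl)
      · exact Or.inr (hk.symm.trans hl)
      · exact Or.inr (inv_eq_iff_eq_inv.1 (hk.symm.trans hl))
      · exact Or.inl (inv_injective (hk.symm.trans hl))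
    rcases h with h | h
    · exact of_injective h
    · simpa [toWord_inv, invRev] using congrArg toWord h
  let π : Equiv.Perm α := Equiv.ofBijective _ (Finite.injective_iff_bijective.1 hinj)
  have hmem : φ * t * permAut π ∈ signedTransvectionGroup i := by
    refine mem_signedTransvectionGroup_of_forall_eq_or i Finset.univ _ (by simp) fun k => ?_
    rw [MulAut.mul_apply, permAut_of]
    exact hof k
  have ht' : t ∈ signedTransvectionGroup i := Or.inl ht
  rwa [Subgroup.mul_mem_cancel_right _ (permAut_mem_signedTransvectionGroup i π),
    Subgroup.mul_mem_cancel_right _ ht'] at hmem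

theorem mem_or_mul_inversion_mem (i : α) (φ : MulAut (FreeGroup α)) :
    φ ∈ transvectionGroup α ∨ φ * inversion i ∈ transvectionGroup α := by
  have : φ ∈ signedTransvectionGroup i := by simp [signedTransvectionGroup_eq_top]
  exact this

theorem index_transvectionGroup [Nonempty α] : (transvectionGroup α).index = 2 := by
  obtain ⟨i⟩ := ‹Nonempty α›
  refine Subgroup.index_eq_two_iff.2 ⟨inversion i, fun φ => ?_⟩
  rcases mem_or_mul_inversion_mem i φ with h | h
  · refine Or.inr ⟨h, fun h' => ?_⟩
    have := detHom_eq_one_of_mem ((Subgroup.mul_mem_cancel_left _ h).1 h')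
    simp [detHom_inversion] at this
  · refine Or.inl ⟨h, fun h' => ?_⟩
    have := detHom_eq_one_of_mem ((Subgroup.mul_mem_cancel_left _ h').1 h)
    simp [detHom_inversion] at this

/-! ### Conjugacy and perfectness in rank at least three -/

theorem exists_ne_ne_of_two_lt_card (hα : 2 < Fintype.card α) (i j : α) : ∃ m, m ≠ i ∧ m ≠ j := by
  obtain ⟨m, -, hm⟩ := Finset.exists_mem_notMem_of_card_lt_card
    (s := {i, j}) (t := Finset.univ) (Finset.card_le_two.trans_lt hα)
  exact ⟨m, by simpa using hm⟩

theorem exists_mem_transvectionGroup_perm (hα : 2 < Fintype.card α) {i j k l : α} (hij : i ≠ j)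
    (hkl : k ≠ l) :
    ∃ t ∈ transvectionGroup α, t (of i) = of k ∧ t (of j) = of l ∧
      ∀ q ≠ i, ∃ r ≠ k, t (of q) = of r ∨ t (of q) = (of r)⁻¹ := by
  obtain ⟨m, hmi, hmj⟩ := exists_ne_ne_of_two_lt_card hα i j
  let π : Equiv.Perm α := Equiv.swap (Equiv.swap i k j) l * Equiv.swap i k
  have hπj : π j = l := by simp [π]
  have hπi : π i = k := by
    have : k ≠ Equiv.swap i k j := fun h => hij <| by
      rw [← Equiv.swap_apply_right i k, Equiv.swap_apply_eq_iff]
      exact h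
    simp [π, Equiv.swap_apply_of_ne_of_ne this hkl]
  have hπ (q : α) (hq : q ≠ i) : π q ≠ k := fun h => hq (π.injective (h.trans hπi.symm))
  rcases mem_or_mul_inversion_mem m (permAut π) with h | h
  · exact ⟨_, h, by simp [hπi], by simp [hπj], fun q hq => ⟨π q, hπ q hq, by simp⟩⟩
  · refine ⟨_, h, by simp [hmi.symm, hπi], by simp [hmj.symm, hπj],
      fun q hq => ⟨π q, hπ q hq, ?_⟩⟩
    by_cases hqm : q = m <;> simp [hqm]

theorem exists_conj_leftTransvection_eq (hα : 2 < Fintype.card α) {i j k l : α} (hij : i ≠ j)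
    (hkl : k ≠ l) :
    ∃ t ∈ transvectionGroup α, t * leftTransvection i j hij * t⁻¹ = leftTransvection k l hkl := by
  obtain ⟨t, ht, hi, hj, hq⟩ := exists_mem_transvectionGroup_perm hα hij hkl
  refine ⟨t, ht, mul_inv_eq_iff_eq_mul.2 (mulAut_ext fun q => ?_)⟩
  by_cases h : q = i
  · simp [h, hi, hj]
  · obtain ⟨r, hr, h' | h'⟩ := hq q h <;> simp [h, hr, h']

theorem exists_conj_rightTransvection_eq (hα : 2 < Fintype.card α) {i j k l : α} (hij : i ≠ j)
    (hkl : k ≠ l) :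
    ∃ t ∈ transvectionGroup α,
      t * rightTransvection i j hij * t⁻¹ = rightTransvection k l hkl := by
  obtain ⟨t, ht, hi, hj, hq⟩ := exists_mem_transvectionGroup_perm hα hij hkl
  refine ⟨t, ht, mul_inv_eq_iff_eq_mul.2 (mulAut_ext fun q => ?_)⟩
  by_cases h : q = i
  · simp [h, hi, hj]
  · obtain ⟨r, hr, h' | h'⟩ := hq q h <;> simp [h, hr, h']

theorem isPerfect_transvectionGroup (hα : 2 < Fintype.card α) :
    Group.IsPerfect (transvectionGroup α) := by
  refine Subgroup.isPerfect_iff.2 (le_antisymm (Subgroup.commutator_le_self _) ?_)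
  refine (Subgroup.closure_le _).2 ?_
  rintro _ ⟨i, j, h, rfl | rfl⟩ <;> obtain ⟨k, hki, hkj⟩ := exists_ne_ne_of_two_lt_card hα i j
  · rw [SetLike.mem_coe, ← inv_mem_iff,
      ← commutator_leftTransvection_rightTransvection h hki.symm hkj]
    exact Subgroup.commutator_mem_commutator (leftTransvection_mem _ _ _)
      (rightTransvection_mem _ _ _)
  · rw [SetLike.mem_coe, ← inv_mem_iff,
      ← commutator_rightTransvection_leftTransvection h hki.symm hkj]
    exact Subgroup.commutator_mem_commutator (rightTransvection_mem _ _ _)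
      (leftTransvection_mem _ _ _)

end Automorphisms

end FreeGroup

/-- **Lemma.** For `n ≥ 3`, `Aut(Fₙ)` contains an index-`2` subgroup `T`
generated by elements `A i j`, `B i j` (`i ≠ j`) such that `T` is perfect
(trivial abelianization) and all the `A`'s are conjugate to each other in `T`,
as are all the `B`'s. -/
theorem autFreeGroup_index_two_perfect_subgroup (n : ℕ) (hn : 3 ≤ n) :
    ∃ T : Subgroup (MulAut (FreeGroup (Fin n))),
      T.index = 2 ∧
      ∃ A B : (i : Fin n) → (j : Fin n) → i ≠ j → MulAut (FreeGroup (Fin n)),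
        (∀ (i j : Fin n) (h : i ≠ j), A i j h ∈ T) ∧
        (∀ (i j : Fin n) (h : i ≠ j), B i j h ∈ T) ∧
        T = Subgroup.closure
          {x | ∃ (i j : Fin n) (h : i ≠ j), x = A i j h ∨ x = B i j h} ∧
        Subsingleton (Abelianization T) ∧
        (∀ (i j k l : Fin n) (hij : i ≠ j) (hkl : k ≠ l),
          ∃ t ∈ T, t * A i j hij * t⁻¹ = A k l hkl) ∧
        (∀ (i j k l : Fin n) (hij : i ≠ j) (hkl : k ≠ l),
          ∃ t ∈ T, t * B i j hij * t⁻¹ = B k l hkl) := by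
  have hα : 2 < Fintype.card (Fin n) := by rw [Fintype.card_fin]; omega
  have : Nonempty (Fin n) := ⟨⟨0, by omega⟩⟩
  have := FreeGroup.isPerfect_transvectionGroup hα
  refine ⟨FreeGroup.transvectionGroup (Fin n), FreeGroup.index_transvectionGroup,
    FreeGroup.leftTransvection, FreeGroup.rightTransvection, FreeGroup.leftTransvection_mem,
    FreeGroup.rightTransvection_mem, rfl, ?_,
    fun _ _ _ _ hij hkl => FreeGroup.exists_conj_leftTransvection_eq hα hij hkl,
    fun _ _ _ _ hij hkl => FreeGroup.exists_conj_rightTransvection_eq hα hij hkl⟩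
  exact QuotientGroup.subsingleton_iff.2 Group.IsPerfect.commutator_eq_top
end
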